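/- Assume d ≥ 3, Ω is irreducible, and the torsion-free group Γ divides Ω. If F is a boundary flat of Ω, then there is a compact set K₀ ⊆ F with ⋃_{γ ∈ Stab_Γ(F)} γ̄(K₀) = F (i.e. the quotient of F by its stabilizer is compact), and the Γ-orbit of F is discrete: no sequence of pairwise distinct flats of the form γ̄(F) with γ ∈ Γ converges to a flat of Ω. -/

import Mathlib

open Set Filter Metric

noncomputable section

/-- `ℝ^d`. -/
abbrev Euc (d : ℕ) := EuclideanSpace ℝ (Fin d)

/-- A flat of `Ω` with prescribed vertices `v`. -/
def IsFlatWith {d : ℕ} (Ω : Set (Euc d)) (v : Fin d → Euc d) : Prop :=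
  AffineIndependent ℝ v ∧
  (∀ j, v j ∈ closure Ω \ Ω) ∧
  intrinsicInterior ℝ (convexHull ℝ (Set.range v)) ⊆ Ω ∧
  convexHull ℝ (Set.range v) \ intrinsicInterior ℝ (convexHull ℝ (Set.range v)) ⊆ closure Ω \ Ω

/-- A (codimension-one, properly embedded) flat of `Ω`. -/
def IsFlat {d : ℕ} (Ω : Set (Euc d)) (F : Set (Euc d)) : Prop :=
  ∃ v : Fin d → Euc d, IsFlatWith Ω v ∧ F = intrinsicInterior ℝ (convexHull ℝ (Set.range v))

/-- The cone over a subset of `ℝ^d`, inside `ℝ^d × ℝ ≅ ℝ^{d+1}`. -/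
def coneOver {d : ℕ} (S : Set (Euc d)) : Set (Euc d × ℝ) :=
  {p | ∃ t : ℝ, 0 < t ∧ ∃ x ∈ S, p = t • (x, (1 : ℝ))}

/-- Irreducibility of a properly convex domain: its cone admits no direct-sum
decomposition into convex cones. -/
def IsIrreducibleDomain {d : ℕ} (Ω : Set (Euc d)) : Prop :=
  ¬ ∃ (V₁ V₂ : Submodule ℝ (Euc d × ℝ)) (C₁ C₂ : Set (Euc d × ℝ)),
      V₁ ≠ ⊥ ∧ V₂ ≠ ⊥ ∧ V₁ ≠ ⊤ ∧ V₂ ≠ ⊤ ∧ IsCompl V₁ V₂ ∧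
      C₁ ⊆ (V₁ : Set (Euc d × ℝ)) ∧ C₂ ⊆ (V₂ : Set (Euc d × ℝ)) ∧
      Convex ℝ C₁ ∧ Convex ℝ C₂ ∧
      (∀ t : ℝ, 0 < t → ∀ c ∈ C₁, t • c ∈ C₁) ∧
      (∀ t : ℝ, 0 < t → ∀ c ∈ C₂, t • c ∈ C₂) ∧
      coneOver Ω = {p | ∃ c₁ ∈ C₁, ∃ c₂ ∈ C₂, p = c₁ + c₂}

/-- The homeomorphism of `Ω` induced by a linear automorphism of `ℝ^{d+1}`
preserving the cone over `Ω`. -/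
def projAct {d : ℕ} (g : (Euc d × ℝ) ≃ₗ[ℝ] (Euc d × ℝ)) (x : Euc d) : Euc d :=
  ((g (x, 1)).2)⁻¹ • (g (x, 1)).1

/-- `Γ` divides `Ω`: every element preserves the cone over `Ω`; the induced action on `Ω`
is free and properly discontinuous, and admits a compact set whose translates cover `Ω`. -/
def Divides {d : ℕ} (Ω : Set (Euc d))
    (Γ : Subgroup ((Euc d × ℝ) ≃ₗ[ℝ] (Euc d × ℝ))) : Prop :=
  (∀ γ ∈ Γ, (γ : (Euc d × ℝ) ≃ₗ[ℝ] (Euc d × ℝ)) '' coneOver Ω = coneOver Ω) ∧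
  (∀ γ ∈ Γ, γ ≠ 1 → ∀ x ∈ Ω, projAct γ x ≠ x) ∧
  (∀ K : Set (Euc d), K ⊆ Ω → IsCompact K →
    {γ : (Euc d × ℝ) ≃ₗ[ℝ] (Euc d × ℝ) | γ ∈ Γ ∧ (projAct γ '' K ∩ K).Nonempty}.Finite) ∧
  (∃ K : Set (Euc d), K ⊆ Ω ∧ IsCompact K ∧ (⋃ γ ∈ Γ, projAct γ '' K) = Ω)

/-- `Γ` is torsion-free. -/
def TorsionFreeSub {d : ℕ} (Γ : Subgroup ((Euc d × ℝ) ≃ₗ[ℝ] (Euc d × ℝ))) : Prop :=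
  ∀ γ ∈ Γ, ∀ n : ℕ, n ≠ 0 → γ ^ n = 1 → γ = 1

/-- Convergence of a sequence of flats: Hausdorff convergence of their closures. -/
def FlatsConverge {d : ℕ} (Fs : ℕ → Set (Euc d)) (F : Set (Euc d)) : Prop :=
  Tendsto (fun i => hausdorffDist (closure (Fs i)) (closure F)) atTop (nhds 0)

/-- A flat is isolated if no sequence of flats, all distinct from it, converges to it. -/
def IsIsolatedFlat {d : ℕ} (Ω F : Set (Euc d)) : Prop :=
  ¬ ∃ Fs : ℕ → Set (Euc d), (∀ i, IsFlat Ω (Fs i)) ∧ (∀ i, Fs i ≠ F) ∧ FlatsConverge Fs F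

/-- The union of all flats of `Ω`. -/
def flatsUnion {d : ℕ} (Ω : Set (Euc d)) : Set (Euc d) := ⋃₀ {F | IsFlat Ω F}

/-- A boundary flat: a flat contained in the closure of a connected component of the
complement of the union of all flats. -/
def IsBoundaryFlat {d : ℕ} (Ω F : Set (Euc d)) : Prop :=
  IsFlat Ω F ∧ ∃ x ∈ Ω \ flatsUnion Ω,
    F ⊆ closure (connectedComponentIn (Ω \ flatsUnion Ω) x)

section SharpCones

variable {V : Type*} [NormedAddCommGroup V] [NormedSpace ℝ V]

/-- A nonempty open convex cone on which a linear functional dominates the norm. -/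
structure SharpCone (C : Set V) (φ : V →L[ℝ] ℝ) (δ : ℝ) : Prop where
  isOpen : IsOpen C
  nonempty : C.Nonempty
  add_mem : ∀ {x y}, x ∈ C → y ∈ C → x + y ∈ C
  smul_mem : ∀ {t : ℝ} {x}, 0 < t → x ∈ C → t • x ∈ C
  pos : 0 < δ
  sharp : ∀ {x}, x ∈ C → δ * ‖x‖ ≤ φ x

namespace SharpCone

variable {C : Set V} {φ : V →L[ℝ] ℝ} {δ : ℝ}

lemma closure_add_mem (h : SharpCone C φ δ) {x y : V} (hx : x ∈ closure C) (hy : y ∈ C) :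
    x + y ∈ C := by
  have hO : IsOpen {x' : V | y - (x' - x) ∈ C} := h.isOpen.preimage (by fun_prop)
  obtain ⟨x', hx', hxC⟩ := mem_closure_iff.1 hx _ hO (by simpa using hy)
  have := h.add_mem hxC hx'
  rwa [show x' + (y - (x' - x)) = x + y by abel] at this

lemma add_closure_mem (h : SharpCone C φ δ) {x y : V} (hx : x ∈ C) (hy : y ∈ closure C) :
    x + y ∈ C := by
  rw [add_comm]; exact h.closure_add_mem hy hx

lemma closure_smul_pos_mem (h : SharpCone C φ δ) {t : ℝ} (ht : 0 < t) {x : V}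
    (hx : x ∈ closure C) : t • x ∈ closure C :=
  map_mem_closure (f := fun x : V => t • x) (by fun_prop) hx (fun _ hy => h.smul_mem ht hy)

lemma zero_mem_closure (h : SharpCone C φ δ) : (0 : V) ∈ closure C := by
  obtain ⟨x, hx⟩ := h.nonempty
  have ht : Tendsto (fun t : ℝ => t • x) (nhdsWithin 0 (Ioi 0)) (nhds 0) := by
    have : Tendsto (fun t : ℝ => t • x) (nhds 0) (nhds ((0 : ℝ) • x)) :=
      Continuous.tendsto (by fun_prop) 0
    rw [zero_smul] at this
    exact this.mono_left nhdsWithin_le_nhds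
  exact mem_closure_of_tendsto ht (eventually_nhdsWithin_of_forall fun t ht => h.smul_mem ht hx)

lemma closure_smul_mem (h : SharpCone C φ δ) {t : ℝ} (ht : 0 ≤ t) {x : V}
    (hx : x ∈ closure C) : t • x ∈ closure C := by
  rcases ht.eq_or_lt with rfl | ht
  · simpa using h.zero_mem_closure
  · exact h.closure_smul_pos_mem ht hx

/-- A point all of whose small translates in one direction of the cone lie in its closure lies
in the closure. -/
lemma mem_closure_of_forall_add (_h : SharpCone C φ δ) {x y : V}
    (hxy : ∀ t : ℝ, 0 < t → x + t • y ∈ closure C) : x ∈ closure C := by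
  have ht : Tendsto (fun t : ℝ => x + t • y) (nhdsWithin 0 (Ioi 0)) (nhds x) := by
    have : Tendsto (fun t : ℝ => x + t • y) (nhds 0) (nhds (x + (0 : ℝ) • y)) :=
      Continuous.tendsto (by fun_prop) 0
    rw [zero_smul, add_zero] at this
    exact this.mono_left nhdsWithin_le_nhds
  have := mem_closure_of_tendsto ht (eventually_nhdsWithin_of_forall fun t ht => hxy t ht)
  rwa [closure_closure] at this

lemma closure_add_closure_mem (h : SharpCone C φ δ) {x y : V} (hx : x ∈ closure C)
    (hy : y ∈ closure C) : x + y ∈ closure C := by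
  obtain ⟨z, hz⟩ := h.nonempty
  refine h.mem_closure_of_forall_add (y := z) fun t ht => ?_
  rw [add_assoc]
  exact subset_closure (h.closure_add_mem hx (h.closure_add_mem hy (h.smul_mem ht hz)))

lemma closure_sum_mem (h : SharpCone C φ δ) {ι : Type*} (s : Finset ι) {f : ι → V}
    (hf : ∀ i ∈ s, f i ∈ closure C) : ∑ i ∈ s, f i ∈ closure C := by
  induction s using Finset.cons_induction with
  | empty => simpa using h.zero_mem_closure
  | cons a s ha ih =>
    rw [Finset.sum_cons]
    exact h.closure_add_closure_mem (hf _ (by simp)) (ih fun i hi => hf i (by simp [hi]))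

lemma nonneg_of_mem_closure {f : V →L[ℝ] ℝ} (hf : ∀ x ∈ C, 0 ≤ f x) {x : V}
    (hx : x ∈ closure C) : 0 ≤ f x :=
  closure_minimal (t := {x | 0 ≤ f x}) hf (isClosed_le continuous_const f.continuous) hx

lemma closure_sharp (h : SharpCone C φ δ) {x : V} (hx : x ∈ closure C) : δ * ‖x‖ ≤ φ x :=
  closure_minimal (t := {x | δ * ‖x‖ ≤ φ x}) (fun _ hx => h.sharp hx)
    (isClosed_le (by fun_prop) (by fun_prop)) hx

lemma norm_le (h : SharpCone C φ δ) {x : V} (hx : x ∈ closure C) : ‖x‖ ≤ δ⁻¹ * φ x := by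
  have := h.closure_sharp hx
  have := h.pos
  rw [inv_mul_eq_div, le_div_iff₀ this]; linarith

lemma nonneg (h : SharpCone C φ δ) {x : V} (hx : x ∈ closure C) : 0 ≤ φ x :=
  le_trans (mul_nonneg h.pos.le (norm_nonneg _)) (h.closure_sharp hx)

lemma pos_of_ne_zero (h : SharpCone C φ δ) {x : V} (hx : x ∈ closure C) (h0 : x ≠ 0) :
    0 < φ x :=
  lt_of_lt_of_le (mul_pos h.pos (norm_pos_iff.2 h0)) (h.closure_sharp hx)

lemma eq_zero_of_neg_mem (h : SharpCone C φ δ) {x : V} (hx : x ∈ closure C)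
    (hx' : -x ∈ closure C) : x = 0 := by
  by_contra h0
  have h1 := h.pos_of_ne_zero hx h0
  have h2 := h.nonneg hx'
  rw [map_neg] at h2; linarith

/-- An open cone contains every small perturbation of a given element. -/
lemma exists_pos_add_smul_mem (h : SharpCone C φ δ) {x : V} (hx : x ∈ C) (y : V) :
    ∃ t : ℝ, 0 < t ∧ x + t • y ∈ C := by
  have hO : IsOpen {t : ℝ | x + t • y ∈ C} := h.isOpen.preimage (by fun_prop)
  obtain ⟨ε, hε, hb⟩ := Metric.isOpen_iff.1 hO 0 (by simpa using hx)
  refine ⟨ε / 2, by positivity, hb ?_⟩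
  simp [abs_of_pos hε, hε]

/-- A functional that is nonnegative on an open cone and vanishes at one of its points is zero. -/
lemma eq_zero_of_dual (h : SharpCone C φ δ) {f : V →L[ℝ] ℝ} (hf : ∀ x ∈ C, 0 ≤ f x)
    {x : V} (hx : x ∈ C) (h0 : f x = 0) : f = 0 := by
  ext v
  obtain ⟨s, hs, hs'⟩ := h.exists_pos_add_smul_mem hx v
  obtain ⟨t, ht, ht'⟩ := h.exists_pos_add_smul_mem hx (-v)
  have h1 := hf _ hs'
  have h2 := hf _ ht'
  simp only [map_add, map_smul, h0, map_neg, smul_eq_mul] at h1 h2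
  simp only [_root_.zero_apply]
  nlinarith

/-- Around a linearly independent family in the closure of the cone, the sum of the family is a
relatively interior point of the part of the closure in the span. -/
lemma exists_ball_subset [FiniteDimensional ℝ V] (h : SharpCone C φ δ) {ι : Type*} [Fintype ι]
    {b : ι → V} (hb : LinearIndependent ℝ b) (hbC : ∀ i, b i ∈ closure C) :
    ∃ r : ℝ, 0 < r ∧ ∀ u ∈ Submodule.span ℝ (range b), ‖u‖ ≤ r → ∑ i, b i + u ∈ closure C := by
  classical
  obtain ⟨K, hK, hanti⟩ := LinearMap.exists_antilipschitzWith (Fintype.linearCombination ℝ b)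
    (LinearMap.ker_eq_bot.2 hb.fintypeLinearCombination_injective)
  have hK' : (0 : ℝ) < K := by exact_mod_cast hK
  refine ⟨(K : ℝ)⁻¹, by positivity, fun u hu hur => ?_⟩
  obtain ⟨c, rfl⟩ : ∃ c : ι → ℝ, Fintype.linearCombination ℝ b c = u := by
    rw [← Fintype.range_linearCombination ℝ] at hu
    exact hu
  have h1 : ‖c‖ ≤ 1 := by
    have := hanti.le_mul_dist c 0
    rw [dist_zero_right, map_zero, dist_zero_right] at this
    calc ‖c‖ ≤ _ := this
      _ ≤ K * (K : ℝ)⁻¹ := by gcongr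
      _ = 1 := mul_inv_cancel₀ hK'.ne'
  rw [Fintype.linearCombination_apply, ← Finset.sum_add_distrib]
  refine h.closure_sum_mem _ fun i _ => ?_
  have h2 : -1 ≤ c i := (abs_le.1 ((norm_le_pi_norm c i).trans h1)).1
  rw [show b i + c i • b i = (1 + c i) • b i by rw [add_smul, one_smul]]
  exact h.closure_smul_mem (by linarith) (hbC i)

end SharpCone

end SharpCones

section Zoom

variable {V : Type*} [NormedAddCommGroup V] [NormedSpace ℝ V]

/-- A linear map sending a ball into a region on which `ψ` dominates the norm is bounded in terms
of the value of `ψ` at the image of the centre. -/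
lemma opNorm_le_of_ball_dominated {ψ : V →L[ℝ] ℝ} {δ ρ M : ℝ} (hδ : 0 < δ) (hρ : 0 < ρ)
    {L : V →L[ℝ] V} {x : V} (hball : ∀ b, ‖b‖ ≤ ρ → δ * ‖L (x + b)‖ ≤ ψ (L (x + b)))
    (hM : ψ (L x) ≤ M) : ‖L‖ ≤ 3 * M / (δ * ρ) := by
  have hM0 : 0 ≤ M := by
    have := hball 0 (by simpa using hρ.le)
    rw [add_zero] at this
    exact (mul_nonneg hδ.le (norm_nonneg _)).trans (this.trans hM)
  refine L.opNorm_le_bound (by positivity) fun v => ?_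
  rcases eq_or_ne v 0 with rfl | hv
  · simp
  have hv' : 0 < ‖v‖ := norm_pos_iff.2 hv
  set b := (ρ / ‖v‖) • v with hb
  have hbn : ‖b‖ = ρ := by
    rw [hb, norm_smul, Real.norm_of_nonneg (by positivity), div_mul_cancel₀ _ hv'.ne']
  have h1 := hball b hbn.le
  have h2 := hball (-b) (by rw [norm_neg, hbn])
  have h0 := hball 0 (by simpa using hρ.le)
  rw [add_zero] at h0
  have h3 : 0 ≤ ψ (L (x + -b)) := (mul_nonneg hδ.le (norm_nonneg _)).trans h2
  have h4 : ‖L b‖ ≤ ‖L (x + b)‖ + ‖L x‖ := by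
    rw [show L b = L (x + b) - L x by rw [map_add]; abel]
    exact norm_sub_le _ _
  rw [map_add, map_add] at h1 h3
  rw [map_neg, map_neg] at h3
  have h5 : δ * ‖L b‖ ≤ 3 * M := by
    calc δ * ‖L b‖ ≤ δ * (‖L (x + b)‖ + ‖L x‖) := by gcongr
      _ ≤ 3 * M := by rw [map_add]; linarith
  have h6 : ‖L b‖ = ρ / ‖v‖ * ‖L v‖ := by
    rw [hb, map_smul, norm_smul, Real.norm_of_nonneg (by positivity)]
  rw [h6] at h5
  rw [div_mul_eq_mul_div, le_div_iff₀ (by positivity)]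
  calc ‖L v‖ * (δ * ρ) = δ * (ρ / ‖v‖ * ‖L v‖) * ‖v‖ := by field_simp
    _ ≤ 3 * M * ‖v‖ := by gcongr

variable [FiniteDimensional ℝ V]

/-- A sharp cone, irreducible in the sense that no one-parameter group of block scalings preserves
it, together with a group of automorphisms acting cocompactly up to scale. -/
structure DividedCone (C : Set V) (φ : V →L[ℝ] ℝ) (δ : ℝ) (Γ : Subgroup (V ≃ₗ[ℝ] V)) : Prop
    extends SharpCone C φ δ where
  invariant : ∀ γ ∈ Γ, ∀ x, γ x ∈ C ↔ x ∈ C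
  cocompact : ∃ K ⊆ C, IsCompact K ∧ ∀ x ∈ C, ∃ γ ∈ Γ, ∃ t : ℝ, 0 < t ∧ t • γ x ∈ K
  irreducible : ∀ P : V →ₗ[ℝ] V, IsIdempotentElem P → P ≠ 0 → P ≠ 1 →
    ¬ ∀ s : ℝ, 0 < s → ∀ x ∈ C, P x + s • (x - P x) ∈ C

lemma exists_projection (U : Submodule ℝ V) {x₀ : V} (hx₀ : x₀ ∉ U) :
    ∃ P : V →L[ℝ] V, (∀ v, P v ∈ U) ∧ (∀ u ∈ U, P u = u) ∧ P x₀ = 0 := by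
  have hdisj : Disjoint (ℝ ∙ x₀) U := by
    refine ((Submodule.disjoint_span_singleton' ?_).2 hx₀).symm
    rintro rfl
    exact hx₀ U.zero_mem
  obtain ⟨M, hM, hMU⟩ := hdisj.exists_isCompl
  refine ⟨(U.projection M hMU.symm).toContinuousLinearMap, fun v => ?_, fun u hu => ?_, ?_⟩
  · simp
  · simpa using Submodule.projection_apply_of_mem_left hMU.symm hu
  · simpa using Submodule.projection_apply_of_mem_right hMU.symm
      (hM (Submodule.mem_span_singleton_self x₀))

namespace SharpCone

variable {C : Set V} {φ : V →L[ℝ] ℝ} {δ : ℝ}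

/-- If `U` is cut out by functionals nonnegative on the cone, one such functional controls the
component of points of the cone transverse to `U`. -/
lemma exists_dual_bound (_h : SharpCone C φ δ) (U : Submodule ℝ V) (P : V →L[ℝ] V)
    (hPU : ∀ v, P v ∈ U) (hPid : ∀ u ∈ U, P u = u)
    (hN : ∀ v, (∀ f : V →L[ℝ] ℝ, (∀ x ∈ C, 0 ≤ f x) → (∀ u ∈ U, f u = 0) → f v = 0) → v ∈ U) :
    ∃ (f₀ : V →L[ℝ] ℝ) (κ : ℝ), 0 < κ ∧ (∀ u ∈ U, f₀ u = 0) ∧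
      ∀ v ∈ C, κ * ‖v - P v‖ ≤ f₀ v := by
  classical
  set N : Set (V →L[ℝ] ℝ) := {f | (∀ x ∈ C, 0 ≤ f x) ∧ ∀ u ∈ U, f u = 0} with hNdef
  obtain ⟨t, htN, hspan⟩ := (Submodule.fg_span_iff_fg_span_finset_subset N).1
    (IsNoetherian.noetherian (Submodule.span ℝ N))
  let T : V →ₗ[ℝ] (t → ℝ) × V :=
    LinearMap.prod (LinearMap.pi fun f : t => (f.1 : V →ₗ[ℝ] ℝ)) (P : V →ₗ[ℝ] V)
  have hker : LinearMap.ker T = ⊥ := by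
    rw [LinearMap.ker_eq_bot']
    intro v hv
    have hP : P v = 0 := congrArg Prod.snd hv
    have hf : ∀ f ∈ t, f v = 0 := fun f hf => congrFun (congrArg Prod.fst hv) ⟨f, hf⟩
    have hall : ∀ f ∈ Submodule.span ℝ N, f v = 0 := by
      rw [hspan]
      intro f hft
      induction hft using Submodule.span_induction with
      | mem f h => exact hf f h
      | zero => simp
      | add f g _ _ h1 h2 => simp [h1, h2]
      | smul c f _ h1 => simp [h1]
    have hvU : v ∈ U := hN v fun f h1 h2 => hall f (Submodule.subset_span ⟨h1, h2⟩)
    rw [← hPid v hvU, hP]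
  obtain ⟨K, hK, hanti⟩ := T.exists_antilipschitzWith hker
  have hK' : (0 : ℝ) < K := by exact_mod_cast hK
  refine ⟨∑ f ∈ t, f, (K : ℝ)⁻¹, by positivity, fun u hu => ?_, fun v hv => ?_⟩
  · rw [_root_.sum_apply]
    exact Finset.sum_eq_zero fun f hf => (htN hf).2 u hu
  · have h1 := hanti.le_mul_dist (v - P v) 0
    rw [dist_zero_right, map_zero, dist_zero_right] at h1
    have h2 : ‖T (v - P v)‖ ≤ ∑ f ∈ t, f v := by
      have hnn : ∀ f ∈ t, 0 ≤ f v := fun f hf => (htN hf).1 v hv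
      refine max_le ?_ ?_
      · refine (pi_norm_le_iff_of_nonneg (Finset.sum_nonneg hnn)).2 fun f => ?_
        have : (T (v - P v)).1 f = f.1 v := by
          change f.1 (v - P v) = f.1 v
          rw [map_sub, (htN f.2).2 _ (hPU v), sub_zero]
        rw [this, Real.norm_of_nonneg (hnn _ f.2)]
        exact Finset.single_le_sum (f := fun g : V →L[ℝ] ℝ => g v) hnn f.2
      · have : (T (v - P v)).2 = 0 := by
          change P (v - P v) = 0
          rw [map_sub, hPid _ (hPU v), sub_self]
        rw [this, norm_zero]
        exact Finset.sum_nonneg hnn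
    rw [inv_mul_eq_div, div_le_iff₀ hK', _root_.sum_apply, mul_comm _ (K : ℝ)]
    exact h1.trans (by gcongr)

end SharpCone

namespace DividedCone

variable {C : Set V} {φ : V →L[ℝ] ℝ} {δ : ℝ} {Γ : Subgroup (V ≃ₗ[ℝ] V)}

lemma zoom_sequence (h : DividedCone C φ δ Γ) (U : Submodule ℝ V) (P : V →L[ℝ] V)
    (hPU : ∀ v, P v ∈ U) (hPid : ∀ u ∈ U, P u = u) {p x₀ : V} (hp : p ∈ U)
    (hpC : p ∈ closure C) (hx₀ : x₀ ∈ C) (hPx₀ : P x₀ = 0) :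
    ∃ K ⊆ C, IsCompact K ∧ ∃ H k : ℕ → V →L[ℝ] V, ∀ n, H n (p + x₀) ∈ K ∧
      (∀ v, k n (H n v) = v) ∧ (∀ v, H n (k n v) = v) ∧
      (∀ x ∈ C, ∃ c ∈ C, k n x = P c + ((n : ℝ) + 1) • (c - P c)) ∧
      ∀ v, P v + ((n : ℝ) + 1)⁻¹ • (v - P v) ∈ C → H n v ∈ C := by
  obtain ⟨K, hKC, hK, hcov⟩ := h.cocompact
  refine ⟨K, hKC, hK, ?_⟩
  have hx : ∀ n : ℕ, p + ((n : ℝ) + 1)⁻¹ • x₀ ∈ C := fun n =>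
    h.closure_add_mem hpC (h.smul_mem (by positivity) hx₀)
  choose γ hγ t ht htK using fun n => hcov _ (hx n)
  have hPP : ∀ v, P (P v) = P v := fun v => hPid _ (hPU v)
  refine ⟨fun n => (t n • ((γ n : V →ₗ[ℝ] V).toContinuousLinearMap)).comp
      (P + ((n : ℝ) + 1)⁻¹ • (ContinuousLinearMap.id ℝ V - P)),
    fun n => (P + ((n : ℝ) + 1) • (ContinuousLinearMap.id ℝ V - P)).comp
      ((t n)⁻¹ • (((γ n).symm : V →ₗ[ℝ] V).toContinuousLinearMap)), fun n => ?_⟩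
  have hn : ((n : ℝ) + 1) ≠ 0 := by positivity
  have htn := (ht n).ne'
  refine ⟨?_, fun v => ?_, fun v => ?_, fun x hx => ?_, fun v hv => ?_⟩
  · have := htK n
    simpa [hPx₀, hPid p hp, smul_comm (t n)] using this
  · simp only [ContinuousLinearMap.comp_apply, _root_.add_apply,
      _root_.smul_apply, _root_.sub_apply, ContinuousLinearMap.id_apply,
      LinearMap.coe_toContinuousLinearMap', LinearEquiv.coe_coe, map_smul,
      LinearEquiv.symm_apply_apply, smul_smul]
    simp [hPP, smul_smul, mul_inv_cancel₀ hn, mul_inv_cancel₀ htn]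
  · simp only [ContinuousLinearMap.comp_apply, _root_.add_apply,
      _root_.smul_apply, _root_.sub_apply, ContinuousLinearMap.id_apply,
      LinearMap.coe_toContinuousLinearMap', LinearEquiv.coe_coe, map_smul, map_add, map_sub, hPP]
    simp only [sub_self, smul_zero, add_zero, ← smul_sub, smul_smul,
      LinearEquiv.apply_symm_apply, add_sub_cancel_left]
    rw [show ((n : ℝ) + 1) * (((n : ℝ) + 1)⁻¹ * t n) = t n by field_simp, ← smul_add, smul_smul,
      inv_mul_cancel₀ htn]
    simp
  · refine ⟨(t n)⁻¹ • (γ n).symm x, h.smul_mem (inv_pos.2 (ht n)) ?_, rfl⟩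
    rw [← h.invariant _ (hγ n), LinearEquiv.apply_symm_apply]
    exact hx
  · exact h.smul_mem (ht n) ((h.invariant _ (hγ n) _).2 hv)

end DividedCone

end Zoom

section ZoomLimit

variable {V : Type*} [NormedAddCommGroup V] [NormedSpace ℝ V]

namespace DividedCone

variable {C : Set V} {φ : V →L[ℝ] ℝ} {δ : ℝ} {Γ : Subgroup (V ≃ₗ[ℝ] V)}

/-- Block scalings that map the cone into its closure preserve the cone, which contradicts
irreducibility. -/
lemma false_of_block_scaling (h : DividedCone C φ δ Γ) (P : V →ₗ[ℝ] V) (hP : IsIdempotentElem P)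
    (h0 : P ≠ 0) (h1 : P ≠ 1)
    (hcl : ∀ s : ℝ, 0 < s → ∀ x ∈ C, P x + s • (x - P x) ∈ closure C) : False := by
  have hPP : ∀ v, P (P v) = P v := fun v => LinearMap.congr_fun hP v
  refine h.irreducible P hP h0 h1 fun s hs x hx => ?_
  obtain ⟨y, hy⟩ := h.nonempty
  obtain ⟨ε, hε, hεC⟩ := h.exists_pos_add_smul_mem hx (-(P y + s⁻¹ • (y - P y)))
  have := h.closure_add_mem (hcl s hs _ hεC) (h.smul_mem hε hy)
  convert this using 1
  simp only [map_add, map_neg, map_smul, map_sub, hPP, sub_self, smul_zero, add_zero]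
  have hs' := hs.ne'
  match_scalars <;> field_simp <;> ring

variable [FiniteDimensional ℝ V]

/-- Zooming in at a point `p` in the relative interior of a face spanning `U`, when the supporting
functionals vanishing on `U` cut out exactly `U`, splits the cone. -/
theorem zoom (h : DividedCone C φ δ Γ) (U : Submodule ℝ V) (hU0 : U ≠ ⊥) (hU1 : U ≠ ⊤)
    {p : V} (hp : p ∈ U) {r : ℝ} (hr : 0 < r) (hball : ∀ u ∈ U, ‖u‖ ≤ r → p + u ∈ closure C)
    (hN : ∀ v, (∀ f : V →L[ℝ] ℝ, (∀ x ∈ C, 0 ≤ f x) → (∀ u ∈ U, f u = 0) → f v = 0) → v ∈ U) :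
    False := by
  obtain ⟨x₀, hx₀⟩ := h.nonempty
  have hx₀U : x₀ ∉ U := by
    intro hmem
    refine hU1 (Submodule.eq_top_iff'.2 fun v => hN v fun f hf hfU => ?_)
    rw [h.eq_zero_of_dual hf hx₀ (hfU _ hmem)]; simp
  have hpC : p ∈ closure C := by simpa using hball 0 U.zero_mem (by simpa using hr.le)
  obtain ⟨P, hPU, hPid, hPx₀⟩ := exists_projection U hx₀U
  have hPP : ∀ v, P (P v) = P v := fun v => hPid _ (hPU v)
  obtain ⟨K, hKC, hK, H, k, hHk⟩ := h.zoom_sequence U P hPU hPid hp hpC hx₀ hPx₀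
  choose hHK hkH hHk hkC hHC using hHk
  obtain ⟨f₀, κ, hκ, hf₀U, hf₀⟩ := h.exists_dual_bound U P hPU hPid hN
  have hδ := h.pos
  have hPx : P (p + x₀) = p := by rw [map_add, hPid p hp, hPx₀, add_zero]
  obtain ⟨M, hM⟩ : ∃ M, ∀ y ∈ K, φ y ≤ M := by
    obtain ⟨M, hM⟩ := hK.bddAbove_image φ.continuous.continuousOn
    exact ⟨M, fun y hy => hM (mem_image_of_mem _ hy)⟩
  -- uniform bound for the maps `H n`
  have hHbound : ∃ B, ∀ n, ‖H n‖ ≤ B := by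
    have hO : IsOpen {b : V | x₀ + (b - P b) ∈ C} := h.isOpen.preimage (by fun_prop)
    obtain ⟨ρ₁, hρ₁, hb₁⟩ := Metric.isOpen_iff.1 hO 0 (by simpa using hx₀)
    have hO' : IsOpen {b : V | ‖P b‖ < r} := isOpen_lt (by fun_prop) continuous_const
    obtain ⟨ρ₂, hρ₂, hb₂⟩ := Metric.isOpen_iff.1 hO' 0 (by simpa using hr)
    have hρ : 0 < min ρ₁ ρ₂ / 2 := by positivity
    refine ⟨3 * M / (δ * (min ρ₁ ρ₂ / 2)), fun n =>
      opNorm_le_of_ball_dominated (ψ := φ) (x := p + x₀) hδ hρ (fun b hb => ?_) (hM _ (hHK n))⟩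
    refine h.sharp (hHC n _ ?_)
    have hm : ‖b‖ < min ρ₁ ρ₂ := lt_of_le_of_lt hb (by linarith)
    have e1 : b ∈ ball (0 : V) ρ₁ := by
      simpa using lt_of_lt_of_le hm (min_le_left _ _)
    have e2 : b ∈ ball (0 : V) ρ₂ := by
      simpa using lt_of_lt_of_le hm (min_le_right _ _)
    have h1 : p + P b ∈ closure C := hball _ (hPU b) (le_of_lt (hb₂ e2))
    have h2 : x₀ + (b - P b) ∈ C := hb₁ e1
    have h3 := h.closure_add_mem h1 (h.smul_mem (t := ((n : ℝ) + 1)⁻¹) (by positivity) h2)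
    convert h3 using 2
    · rw [map_add, hPx]
    · rw [map_add, hPx]; congr 1; abel
  -- uniform bound for the inverse maps
  have hkbound : ∃ B, ∀ n, ‖k n‖ ≤ B := by
    obtain ⟨ρ, hρ, hthick⟩ := hK.exists_cthickening_subset_open h.isOpen hKC
    set ψ : V →L[ℝ] ℝ := φ.comp P + ((2 * δ + ‖φ‖) / κ) • f₀ with hψ
    refine ⟨3 * ψ (p + x₀) / (δ * ρ), fun n =>
      opNorm_le_of_ball_dominated (ψ := ψ) (x := H n (p + x₀)) hδ hρ (fun b hb => ?_)
        (by rw [hkH])⟩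
    have hin : H n (p + x₀) + b ∈ C := hthick (mem_cthickening_of_dist_le _ _ _ _ (hHK n)
      (by simpa using hb))
    obtain ⟨c, hc, hkc⟩ := hkC n _ hin
    rw [hkc]
    have ht : (1 : ℝ) ≤ (n : ℝ) + 1 := by linarith [(Nat.cast_nonneg n : (0 : ℝ) ≤ n)]
    set t : ℝ := (n : ℝ) + 1
    set q := c - P c with hq
    have hPq : P q = 0 := by rw [hq, map_sub, hPP, sub_self]
    have hψv : ψ (P c + t • q) = φ (P c) + (2 * δ + ‖φ‖) / κ * (t * f₀ c) := by
      have e1 : f₀ (P c) = 0 := hf₀U _ (hPU c)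
      have e2 : f₀ q = f₀ c := by rw [hq, map_sub, e1, sub_zero]
      simp [hψ, hPP, hPq, e1, e2]
    have g1 : κ * ‖q‖ ≤ f₀ c := hf₀ c hc
    have g2 : (2 * δ + ‖φ‖) * (t * ‖q‖) ≤ (2 * δ + ‖φ‖) / κ * (t * f₀ c) := by
      calc (2 * δ + ‖φ‖) * (t * ‖q‖) = (2 * δ + ‖φ‖) / κ * (t * (κ * ‖q‖)) := by field_simp
        _ ≤ _ := by gcongr
    have g3 : φ c - ‖φ‖ * ‖q‖ ≤ φ (P c) := by
      have : φ (P c) = φ c - φ q := by rw [hq, map_sub]; ring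
      have h' := (le_abs_self (φ q)).trans (φ.le_opNorm q)
      linarith
    have g4 : δ * ‖c‖ ≤ φ c := h.sharp hc
    have g5 : ‖P c‖ ≤ ‖c‖ + ‖q‖ := by
      rw [show P c = c - q by rw [hq]; abel]; exact norm_sub_le _ _
    have g6 : ‖P c + t • q‖ ≤ ‖P c‖ + t * ‖q‖ := by
      refine (norm_add_le _ _).trans ?_
      rw [norm_smul, Real.norm_of_nonneg (by linarith)]
    have g7 : ‖q‖ ≤ t * ‖q‖ := le_mul_of_one_le_left (norm_nonneg _) ht
    rw [hψv]
    have g8 : δ * ‖P c + t • q‖ ≤ δ * (‖c‖ + ‖q‖ + t * ‖q‖) := by gcongr; linarith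
    have g9 : (δ + ‖φ‖) * ‖q‖ ≤ (δ + ‖φ‖) * (t * ‖q‖) := by gcongr
    linarith
  -- pass to the limit
  obtain ⟨BH, hBH⟩ := hHbound
  obtain ⟨Bk, hBk⟩ := hkbound
  obtain ⟨⟨L, l⟩, -, θ, hθ, hlim⟩ := tendsto_subseq_of_bounded
    (s := closedBall (0 : V →L[ℝ] V) BH ×ˢ closedBall (0 : V →L[ℝ] V) Bk)
    (isBounded_closedBall.prod isBounded_closedBall) (x := fun n => (H n, k n))
    (fun n => ⟨by simpa using hBH n, by simpa using hBk n⟩)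
  have hL : Tendsto (fun n => H (θ n)) atTop (nhds L) := (continuous_fst.tendsto _).comp hlim
  have hl : Tendsto (fun n => k (θ n)) atTop (nhds l) := (continuous_snd.tendsto _).comp hlim
  have happ : ∀ {A : ℕ → V →L[ℝ] V} {A' : V →L[ℝ] V} {v : ℕ → V} {w : V},
      Tendsto A atTop (nhds A') → Tendsto v atTop (nhds w) →
      Tendsto (fun n => A n (v n)) atTop (nhds (A' w)) := fun {_ A' _ w} hA hv =>
    (isBoundedBilinearMap_apply.continuous.tendsto (A', w)).comp (hA.prodMk_nhds hv)
  have hLl : ∀ v, L (l v) = v := fun v =>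
    tendsto_nhds_unique (happ hL (happ hl (tendsto_const_nhds (x := v))))
      (tendsto_const_nhds.congr fun n => (hHk _ v).symm)
  have hlL : ∀ v, l (L v) = v := fun v =>
    tendsto_nhds_unique (happ hl (happ hL (tendsto_const_nhds (x := v))))
      (tendsto_const_nhds.congr fun n => (hkH _ v).symm)
  have hscale : Tendsto (fun n => (((θ n : ℕ) : ℝ) + 1)⁻¹) atTop (nhds 0) :=
    (tendsto_inv_atTop_zero.comp (tendsto_atTop_add_const_right _ _
      tendsto_natCast_atTop_atTop)).comp hθ.tendsto_atTop
  -- the limit of the zoomed cones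
  have hlC : ∀ x ∈ C, P (l x) ∈ closure C ∧
      l x - P (l x) ∈ closure ((fun c => c - P c) '' C) := by
    intro x hx
    choose c hc hkc using fun n => hkC (θ n) x hx
    have hlx : Tendsto (fun n => k (θ n) x) atTop (nhds (l x)) :=
      happ hl (tendsto_const_nhds (x := x))
    have hP1 : Tendsto (fun n => P (k (θ n) x)) atTop (nhds (P (l x))) :=
      (P.continuous.tendsto _).comp hlx
    have hQ1 := hlx.sub hP1
    have hPc : ∀ n, P (k (θ n) x) = P (c n) := fun n => by
      rw [hkc n]; simp [hPP]
    have hQc : ∀ n, k (θ n) x - P (k (θ n) x) = (((θ n : ℕ) : ℝ) + 1) • (c n - P (c n)) :=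
      fun n => by rw [hPc, hkc n]; abel
    constructor
    · have : Tendsto c atTop (nhds (P (l x) + (0 : ℝ) • (l x - P (l x)))) := by
        refine (hP1.add (hscale.smul hQ1)).congr fun n => ?_
        have : (((θ n : ℕ) : ℝ) + 1) ≠ 0 := by positivity
        rw [hQc, hPc, smul_smul, inv_mul_cancel₀ this, one_smul]; abel
      rw [zero_smul, add_zero] at this
      exact mem_closure_of_tendsto this (Eventually.of_forall hc)
    · refine mem_closure_of_tendsto hQ1 (Eventually.of_forall fun n => ?_)
      refine ⟨(((θ n : ℕ) : ℝ) + 1) • c n, h.smul_mem (by positivity) (hc n), ?_⟩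
      simp only [hQc, map_smul, smul_sub]
  have hLC : ∀ u m : V, P u = u → u ∈ closure C → P m = 0 →
      m ∈ closure ((fun c => c - P c) '' C) → L (u + m) ∈ closure C := by
    intro u m hPu huC hPm hm
    refine h.mem_closure_of_forall_add (y := L (p + x₀)) fun ε hε => ?_
    rw [← map_smul, ← map_add]
    have hO : IsOpen {q : V | ε • x₀ + (m - q) ∈ C} := h.isOpen.preimage (by fun_prop)
    obtain ⟨_, hcO, c, hc, rfl⟩ := mem_closure_iff.1 hm _ hO (by simpa using h.smul_mem hε hx₀)
    refine mem_closure_of_tendsto (happ hL (tendsto_const_nhds (x := u + m + ε • (p + x₀)))) ?_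
    have hsmall : ∀ᶠ n in atTop, ‖(((θ n : ℕ) : ℝ) + 1)⁻¹ • P c‖ < ε * r := by
      have : Tendsto (fun n => ‖(((θ n : ℕ) : ℝ) + 1)⁻¹ • P c‖) atTop
          (nhds ‖(0 : ℝ) • P c‖) := (hscale.smul_const _).norm
      rw [zero_smul, norm_zero] at this
      exact this.eventually_lt_const (by positivity)
    filter_upwards [hsmall] with n hn
    refine hHC _ _ ?_
    set τ := (((θ n : ℕ) : ℝ) + 1)⁻¹ with hτ
    have hτ0 : 0 < τ := by positivity
    have e1 : ε • (p + (ε⁻¹ * -τ) • P c) ∈ closure C := by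
      refine h.closure_smul_mem hε.le (hball _ (U.smul_mem _ (hPU c)) ?_)
      rw [mul_smul, norm_smul, neg_smul, norm_neg, norm_inv, Real.norm_of_nonneg hε.le,
        inv_mul_le_iff₀ hε]
      exact hn.le
    have e2 : τ • (c + (ε • x₀ + (m - (c - P c)))) ∈ C :=
      h.smul_mem hτ0 (h.add_mem hc hcO)
    have := h.closure_add_mem (h.closure_add_closure_mem huC e1) e2
    convert this using 1
    simp only [map_add, map_smul, hPu, hPm, hPid p hp, hPx₀]
    have := hε.ne'
    match_scalars <;> field_simp <;> ring
  -- conclude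
  refine h.false_of_block_scaling ((L.comp (P.comp l) : V →L[ℝ] V) : V →ₗ[ℝ] V) ?_ ?_ ?_ ?_
  · ext v
    simp [hlL, hPP]
  · intro h0
    obtain ⟨u, hu, hu0⟩ := Submodule.exists_mem_ne_zero_of_ne_bot hU0
    have := LinearMap.congr_fun h0 (L u)
    have h2 : L u = 0 := by simpa [hlL, hPid u hu] using this
    exact hu0 (by rw [← hlL u, h2, map_zero])
  · intro h1
    refine hU1 (Submodule.eq_top_iff'.2 fun v => ?_)
    have h2 : L (P v) = L v := by simpa [hlL] using LinearMap.congr_fun h1 (L v)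
    rw [← hlL v, ← h2, hlL]; exact hPU v
  · intro s hs x hx
    obtain ⟨h1, h2⟩ := hlC x hx
    have h3 : s • (l x - P (l x)) ∈ closure ((fun c => c - P c) '' C) := by
      refine map_mem_closure (f := fun v : V => s • v) (by fun_prop) h2 ?_
      rintro _ ⟨c, hc, rfl⟩
      exact ⟨s • c, h.smul_mem hs hc, by simp [smul_sub]⟩
    have := hLC (P (l x)) (s • (l x - P (l x))) (hPP _) h1 (by simp [hPP]) h3
    simpa [hLl] using this

/-- The span of a nonempty linearly independent family in the closure of the cone is not cut out
by supporting functionals. -/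
theorem span_not_cut_out (h : DividedCone C φ δ Γ) {ι : Type*} [Fintype ι] [Nonempty ι]
    {b : ι → V} (hb : LinearIndependent ℝ b) (hbC : ∀ i, b i ∈ closure C)
    (htop : Submodule.span ℝ (range b) ≠ ⊤) :
    ∃ v ∉ Submodule.span ℝ (range b), ∀ f : V →L[ℝ] ℝ, (∀ x ∈ C, 0 ≤ f x) →
      (∀ i, f (b i) = 0) → f v = 0 := by
  by_contra! hcon
  obtain ⟨r, hr, hball⟩ := h.exists_ball_subset hb hbC
  refine h.zoom (Submodule.span ℝ (range b)) ?_ htop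
    (Submodule.sum_mem _ fun i _ => Submodule.subset_span ⟨i, rfl⟩) hr hball fun v hv => ?_
  · obtain ⟨i⟩ := ‹Nonempty ι›
    exact Submodule.ne_bot_iff _ |>.2 ⟨b i, Submodule.subset_span ⟨i, rfl⟩, hb.ne_zero i⟩
  · by_contra hvU
    obtain ⟨f, hf, hfb, hfv⟩ := hcon v hvU
    refine hfv (hv f hf fun u hu => ?_)
    induction hu using Submodule.span_induction with
    | mem u h => obtain ⟨i, rfl⟩ := h; exact hfb i
    | zero => simp
    | add f g _ _ h1 h2 => simp [h1, h2]
    | smul c f _ h1 => simp [h1]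

end DividedCone

end ZoomLimit

section Frames

variable {V : Type*} [NormedAddCommGroup V] [NormedSpace ℝ V] {ι : Type*} [Fintype ι]

/-- A family spanning a simplicial slice of the cone: a linear combination of the family lies in
the cone exactly when all its coefficients are positive. -/
def IsFrame (C : Set V) (e : ι → V) : Prop :=
  ∀ a : ι → ℝ, ∑ i, a i • e i ∈ C ↔ ∀ i, 0 < a i

namespace SharpCone

variable {C : Set V} {φ : V →L[ℝ] ℝ} {δ : ℝ}

lemma convex (h : SharpCone C φ δ) : Convex ℝ C :=
  convex_iff_forall_pos.2 fun _ hx _ hy _ _ ha hb _ =>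
    h.add_mem (h.smul_mem ha hx) (h.smul_mem hb hy)

end SharpCone

namespace IsFrame

variable {C : Set V} {φ : V →L[ℝ] ℝ} {δ : ℝ} {e : ι → V}

lemma sum_mem (he : IsFrame C e) : ∑ i, e i ∈ C := by
  simpa using (he fun _ => 1).2 fun _ => one_pos

lemma linearIndependent (he : IsFrame C e) : LinearIndependent ℝ e := by
  rw [Fintype.linearIndependent_iff]
  intro c hc i
  by_contra hi
  have key : ∀ t : ℝ, ∑ j, (1 + t * c j) • e j ∈ C := fun t => by
    have : ∑ j, (1 + t * c j) • e j = ∑ j, e j := by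
      simp only [add_smul, one_smul, mul_smul, Finset.sum_add_distrib, ← Finset.smul_sum, hc,
        smul_zero, add_zero]
    rw [this]; exact he.sum_mem
  have := (he _).1 (key (-(c i)⁻¹)) i
  rw [neg_mul, inv_mul_cancel₀ hi] at this
  simp at this

lemma mem_closure (h : SharpCone C φ δ) (he : IsFrame C e) (i : ι) : e i ∈ closure C := by
  classical
  refine h.mem_closure_of_forall_add (y := ∑ j, e j) fun t ht => subset_closure ?_
  have : e i + t • ∑ j, e j = ∑ j, ((if i = j then 1 else 0) + t) • e j := by
    simp [add_smul, Finset.sum_add_distrib, Finset.smul_sum]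
  rw [this]
  refine (he _).2 fun j => ?_
  split_ifs <;> linarith

lemma sum_mem_closure_iff (h : SharpCone C φ δ) (he : IsFrame C e) {a : ι → ℝ} :
    ∑ i, a i • e i ∈ closure C ↔ ∀ i, 0 ≤ a i := by
  refine ⟨fun ha i => ?_, fun ha => h.closure_sum_mem _ fun i _ =>
    h.closure_smul_mem (ha i) (he.mem_closure h i)⟩
  refine le_of_forall_pos_le_add fun ε hε => ?_
  have := h.closure_add_mem ha (h.smul_mem hε he.sum_mem)
  rw [Finset.smul_sum, ← Finset.sum_add_distrib] at this
  simp only [← add_smul] at this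
  exact ((he _).1 this i).le

/-- The functionals dual to a frame extend to supporting functionals of the cone. -/
lemma exists_dual [DecidableEq ι] (h : SharpCone C φ δ) (he : IsFrame C e) (j : ι) :
    ∃ f : V →L[ℝ] ℝ, (∀ x ∈ C, 0 ≤ f x) ∧ ∀ i, f (e i) = if i = j then 1 else 0 := by
  set p := ∑ i, (if i = j then (0 : ℝ) else 1) • e i with hp
  have hpC : p ∉ C := fun hmem => by simpa using (he _).1 hmem j
  have hsum : ∑ i, e i = p + e j := by
    have : e j = ∑ i, (if i = j then (1 : ℝ) else 0) • e i := by simp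
    rw [hp, this, ← Finset.sum_add_distrib]
    refine Finset.sum_congr rfl fun i _ => ?_
    split_ifs <;> simp
  obtain ⟨f, hf⟩ := geometric_hahn_banach_open_point h.convex h.isOpen hpC
  have hf0 : ∀ x ∈ C, f x ≤ 0 := fun x hx => by
    by_contra! hpos
    have hq : 0 < (|f p| + 1) / f x := by positivity
    have h1 := hf _ (h.smul_mem hq hx)
    rw [map_smul, smul_eq_mul, div_mul_cancel₀ _ hpos.ne'] at h1
    linarith [le_abs_self (f p)]
  have hfn : ∀ x ∈ C, 0 ≤ (-f) x := fun x hx => by simpa using hf0 x hx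
  have hfe : ∀ i, f (e i) ≤ 0 := fun i => by
    have := SharpCone.nonneg_of_mem_closure hfn (he.mem_closure h i)
    simpa using this
  have hfp : 0 ≤ f p := by
    by_contra! hneg
    obtain ⟨x, hx⟩ := h.nonempty
    have hx0 : f x < 0 := (hf x hx).trans hneg
    have hq : 0 < f p / (2 * f x) := div_pos_of_neg_of_neg hneg (by linarith)
    have h1 := hf _ (h.smul_mem hq hx)
    rw [map_smul, smul_eq_mul] at h1
    have : f p / (2 * f x) * f x = f p / 2 := by field_simp [hx0.ne]
    linarith
  have hej : f (e j) < 0 := by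
    have := hf _ he.sum_mem
    rw [hsum, map_add] at this; linarith
  have hei : ∀ i, i ≠ j → f (e i) = 0 := fun i hij => by
    have h1 : ∀ k ∈ Finset.univ, (if k = j then (0 : ℝ) else 1) * f (e k) ≤ 0 := fun k _ => by
      split_ifs <;> simp [hfe]
    have h2 : ∑ k, (if k = j then (0 : ℝ) else 1) * f (e k) = 0 := by
      refine le_antisymm (Finset.sum_nonpos h1) ?_
      simpa only [hp, map_sum, map_smul, smul_eq_mul] using hfp
    have := (Finset.sum_eq_zero_iff_of_nonpos h1).1 h2 i (Finset.mem_univ _)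
    simpa [hij] using this
  refine ⟨(f (e j))⁻¹ • f, fun x hx => ?_, fun i => ?_⟩
  · simpa using mul_nonneg_of_nonpos_of_nonpos (inv_nonpos.2 hej.le) (hf0 x hx)
  · split_ifs with hij
    · subst hij; simp [hej.ne]
    · simp [hei i hij]

end IsFrame

namespace DividedCone

variable [FiniteDimensional ℝ V] {C : Set V} {φ : V →L[ℝ] ℝ} {δ : ℝ}
  {Γ : Subgroup (V ≃ₗ[ℝ] V)} {e : ι → V}

/-- A point of the closed cone killed by one of the dual functionals of a frame lies in its
span. -/
lemma mem_span_of_dual_eq_zero [DecidableEq ι] (h : DividedCone C φ δ Γ)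
    (hdim : Module.finrank ℝ V = Fintype.card ι + 1) (he : IsFrame C e) {j : ι} {f : V →L[ℝ] ℝ}
    (hf : ∀ x ∈ C, 0 ≤ f x) (hfe : ∀ i, f (e i) = if i = j then 1 else 0) {c : V}
    (hc : c ∈ closure C) (hfc : f c = 0) : c ∈ Submodule.span ℝ (range e) := by
  by_contra hcs
  have hb : LinearIndependent ℝ (Function.update e j c) := by
    rw [Fintype.linearIndependent_iff]
    intro g hg
    have hsum : ∑ i, g i • Function.update e j c i
        = g j • c + ∑ i ∈ Finset.univ.erase j, g i • e i := by
      rw [← Finset.add_sum_erase _ _ (Finset.mem_univ j), Function.update_self]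
      congr 1
      exact Finset.sum_congr rfl fun i hi => by
        rw [Function.update_of_ne (Finset.ne_of_mem_erase hi)]
    rw [hsum] at hg
    have hgj : g j = 0 := by
      by_contra hgj
      refine hcs ?_
      have : c = (g j)⁻¹ • (-∑ i ∈ Finset.univ.erase j, g i • e i) := by
        rw [← eq_neg_iff_add_eq_zero.2 hg, smul_smul, inv_mul_cancel₀ hgj, one_smul]
      rw [this]
      exact Submodule.smul_mem _ _ (Submodule.neg_mem _ (Submodule.sum_mem _ fun i _ =>
        Submodule.smul_mem _ _ (Submodule.subset_span ⟨i, rfl⟩)))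
    rw [hgj, zero_smul, zero_add] at hg
    have := linearIndependent_iff'.1 he.linearIndependent _ _ hg
    intro i
    by_cases hij : i = j
    · rw [hij, hgj]
    · exact this i (Finset.mem_erase.2 ⟨hij, Finset.mem_univ _⟩)
  have hbf : ∀ i, f (Function.update e j c i) = 0 := fun i => by
    by_cases hij : i = j
    · subst hij; simpa using hfc
    · rw [Function.update_of_ne hij, hfe, if_neg hij]
  have hbC : ∀ i, Function.update e j c i ∈ closure C := fun i => by
    by_cases hij : i = j
    · subst hij; simpa using hc
    · rw [Function.update_of_ne hij]; exact he.mem_closure h.toSharpCone i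
  have hle : Submodule.span ℝ (range (Function.update e j c)) ≤ LinearMap.ker (f : V →ₗ[ℝ] ℝ) := by
    rw [Submodule.span_le]
    rintro _ ⟨i, rfl⟩
    exact hbf i
  have hf0 : (f : V →ₗ[ℝ] ℝ) ≠ 0 := fun h0 => by
    have := LinearMap.congr_fun h0 (e j)
    simp [hfe] at this
  have hker := Module.Dual.finrank_ker_add_one_of_ne_zero hf0
  have heq := Submodule.eq_of_le_of_finrank_eq hle (by
    rw [finrank_span_eq_card hb]; omega)
  have : Nonempty ι := ⟨j⟩
  obtain ⟨v, hv, hvf⟩ := h.span_not_cut_out hb hbC (fun htop => by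
    rw [htop] at heq
    exact hf0 (LinearMap.ker_eq_top.1 heq.symm))
  exact hv (heq ▸ hvf f hf hbf)

/-- Every point of the closed cone on a supporting hyperplane that meets a frame's slice only in
its boundary lies in the span of the frame. -/
lemma mem_span_of_supporting (h : DividedCone C φ δ Γ)
    (hdim : Module.finrank ℝ V = Fintype.card ι + 1) (he : IsFrame C e) {p : V}
    (hp : p ∈ Submodule.span ℝ (range e)) (hpC : p ∈ closure C) (hp0 : p ≠ 0)
    {g : V →L[ℝ] ℝ} (hg : ∀ x ∈ C, 0 ≤ g x) (hgp : g p = 0) (hg0 : g ≠ 0)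
    {x : V} (hx : x ∈ closure C) (hgx : g x = 0) : x ∈ Submodule.span ℝ (range e) := by
  classical
  have hS := h.toSharpCone
  choose f hf hfe using fun j => he.exists_dual hS j
  obtain ⟨a, rfl⟩ := Submodule.mem_span_range_iff_exists_fun ℝ |>.1 hp
  have ha := (he.sum_mem_closure_iff hS).1 hpC
  have hge : ∀ i, 0 ≤ g (e i) := fun i => SharpCone.nonneg_of_mem_closure hg (he.mem_closure hS i)
  have hgI : ∀ i, 0 < a i → g (e i) = 0 := fun i hi => by
    rw [map_sum] at hgp
    have := (Finset.sum_eq_zero_iff_of_nonneg (fun k _ => by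
      rw [map_smul]; exact mul_nonneg (ha k) (hge k))).1 hgp i (Finset.mem_univ _)
    rw [map_smul, smul_eq_mul] at this
    exact (mul_eq_zero.1 this).resolve_left hi.ne'
  obtain ⟨i₀, hi₀⟩ : ∃ i, 0 < a i := by
    by_contra! hall
    refine hp0 (Finset.sum_eq_zero fun i _ => ?_)
    rw [le_antisymm (hall i) (ha i), zero_smul]
  have : Nonempty {i // 0 < a i} := ⟨⟨i₀, hi₀⟩⟩
  have hfin : ∀ {κ : Type _} [Fintype κ] (b : κ → V), Fintype.card κ ≤ Fintype.card ι →
      Submodule.span ℝ (range b) ≠ ⊤ := fun b hcard htop => by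
    have := finrank_range_le_card (R := ℝ) b
    rw [Set.finrank, htop, finrank_top] at this
    omega
  obtain ⟨v, hv, hvf⟩ := h.span_not_cut_out (b := fun i : {i // 0 < a i} => e i)
    (he.linearIndependent.comp _ Subtype.val_injective) (fun i => he.mem_closure hS i)
    (hfin _ (Fintype.card_subtype_le _))
  have hgv : g v = 0 := hvf g hg fun i => hgI i i.2
  have hfv : ∀ j, ¬ 0 < a j → f j v = 0 := fun j hj => hvf _ (hf j) fun i => by
    rw [hfe, if_neg]; rintro rfl; exact hj i.2
  have hve : v ∉ Submodule.span ℝ (range e) := by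
    intro hmem
    obtain ⟨c, rfl⟩ := Submodule.mem_span_range_iff_exists_fun ℝ |>.1 hmem
    refine hv (Submodule.sum_mem _ fun j _ => ?_)
    by_cases hj : 0 < a j
    · exact Submodule.smul_mem _ _ (Submodule.subset_span ⟨⟨j, hj⟩, rfl⟩)
    · have := hfv j hj
      simp [map_sum, hfe] at this
      rw [this, zero_smul]; exact Submodule.zero_mem _
  have hdec : ∀ y : V, ∃ (c : ι → ℝ) (τ : ℝ), y = ∑ i, c i • e i + τ • v := by
    have hb : LinearIndependent ℝ (fun o : Option ι => o.elim v e) :=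
      linearIndependent_option.2 ⟨he.linearIndependent, hve⟩
    have htop := hb.span_eq_top_of_card_eq_finrank (by rw [hdim, Fintype.card_option])
    intro y
    obtain ⟨c, hc⟩ := Submodule.mem_span_range_iff_exists_fun ℝ |>.1
      (htop ▸ Submodule.mem_top : y ∈ _)
    refine ⟨fun i => c (some i), c none, ?_⟩
    rw [← hc, Fintype.sum_option, add_comm]; rfl
  have hfvg : ∀ i, f i v * g (e i) = 0 := fun i => by
    by_cases hi : 0 < a i
    · rw [hgI i hi, mul_zero]
    · rw [hfv i hi, zero_mul]
  have hgsum : ∀ y, g y = ∑ i, f i y * g (e i) := fun y => by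
    obtain ⟨c, τ, rfl⟩ := hdec y
    simp [map_sum, hfe, hgv, add_mul, mul_assoc, hfvg]
  obtain ⟨k, hk⟩ : ∃ k, g (e k) ≠ 0 := by
    by_contra! hall
    refine hg0 (ContinuousLinearMap.ext fun y => ?_)
    rw [hgsum]; simp [hall]
  rw [hgsum] at hgx
  have := (Finset.sum_eq_zero_iff_of_nonneg (fun k _ => mul_nonneg
    (SharpCone.nonneg_of_mem_closure (hf k) hx) (hge k))).1 hgx k (Finset.mem_univ _)
  exact h.mem_span_of_dual_eq_zero hdim he (hf k) (hfe k) hx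
    ((mul_eq_zero.1 this).resolve_right hk)

end DividedCone

end Frames

lemma span_range_smul {V : Type*} [NormedAddCommGroup V] [NormedSpace ℝ V] {ι : Type*}
    {e : ι → V} {r : ι → ℝ} (hr : ∀ i, r i ≠ 0) :
    Submodule.span ℝ (range fun i => r i • e i) = Submodule.span ℝ (range e) := by
  refine le_antisymm (Submodule.span_le.2 ?_) (Submodule.span_le.2 ?_)
  · rintro _ ⟨i, rfl⟩
    exact Submodule.smul_mem _ _ (Submodule.subset_span ⟨i, rfl⟩)
  · rintro _ ⟨i, rfl⟩
    have := Submodule.smul_mem (Submodule.span ℝ (range fun i => r i • e i)) (r i)⁻¹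
      (Submodule.subset_span ⟨i, rfl⟩)
    simpa [smul_smul, inv_mul_cancel₀ (hr i)] using this

section Rigidity

variable {V : Type*} [NormedAddCommGroup V] [NormedSpace ℝ V] {ι : Type*} [Fintype ι]
  {C : Set V} {φ : V →L[ℝ] ℝ} {δ : ℝ} {Γ : Subgroup (V ≃ₗ[ℝ] V)} {e e' : ι → V}

lemma IsFrame.finrank_span (he : IsFrame C e) :
    Module.finrank ℝ (Submodule.span ℝ (range e)) = Fintype.card ι :=
  finrank_span_eq_card he.linearIndependent

/-- Multiplying the members of a frame by positive scalars gives a frame. -/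
lemma IsFrame.pos_smul (he : IsFrame C e) {r : ι → ℝ} (hr : ∀ i, 0 < r i) :
    IsFrame C (fun i => r i • e i) := fun a => by
  simp only [smul_smul]
  rw [he]
  exact forall_congr' fun i => mul_pos_iff_of_pos_right (hr i)

namespace DividedCone

variable [FiniteDimensional ℝ V]

lemma mem_span_of_dual_eq_zero_of_ne [DecidableEq ι] (h : DividedCone C φ δ Γ)
    (hdim : Module.finrank ℝ V = Fintype.card ι + 1) (he : IsFrame C e) (he' : IsFrame C e')
    {b : ι → ℝ} {j : ι} (hp : ∑ i, b i • e' i ∈ Submodule.span ℝ (range e))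
    (hpC : ∑ i, b i • e' i ∈ closure C) (hp0 : ∑ i, b i • e' i ≠ 0) (hbj : b j = 0) {i : ι}
    (hij : i ≠ j) : e' i ∈ Submodule.span ℝ (range e) := by
  obtain ⟨g, hg, hge⟩ := he'.exists_dual h.toSharpCone j
  refine h.mem_span_of_supporting hdim he hp hpC hp0 hg ?_ ?_ (he'.mem_closure h.toSharpCone i) ?_
  · simp [map_sum, hge, hbj]
  · rintro rfl; simpa using hge j
  · simp [hge, hij]

/-- Two frames whose spans share a nonzero boundary point of the cone have the same span. -/
lemma span_eq_of_common_boundary_point (h : DividedCone C φ δ Γ)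
    (hdim : Module.finrank ℝ V = Fintype.card ι + 1) (hcard : 3 ≤ Fintype.card ι)
    (he : IsFrame C e) (he' : IsFrame C e') {p : V} (hp : p ∈ Submodule.span ℝ (range e))
    (hp' : p ∈ Submodule.span ℝ (range e')) (hpC : p ∈ closure C) (hpn : p ∉ C) (hp0 : p ≠ 0) :
    Submodule.span ℝ (range e) = Submodule.span ℝ (range e') := by
  classical
  have havoid : ∀ i k : ι, ∃ j, j ≠ i ∧ j ≠ k := fun i k => by
    by_contra! hall
    have h1 : (Finset.univ : Finset ι) ⊆ {i, k} := fun j _ => by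
      by_cases hj : j = i
      · simp [hj]
      · simp [hall j hj]
    have := (Finset.card_le_card h1).trans Finset.card_le_two
    rw [Finset.card_univ] at this; omega
  obtain ⟨b, rfl⟩ := Submodule.mem_span_range_iff_exists_fun ℝ |>.1 hp'
  have hb := (he'.sum_mem_closure_iff h.toSharpCone).1 hpC
  obtain ⟨j, hj⟩ : ∃ j, b j ≤ 0 := by
    by_contra! hall
    exact hpn ((he' b).2 hall)
  have hbj := le_antisymm hj (hb j)
  obtain ⟨i, hij, -⟩ := havoid j j
  have hi := h.mem_span_of_dual_eq_zero_of_ne hdim he he' hp hpC hp0 hbj hij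
  have hsum : ∑ k, (if k = i then (1 : ℝ) else 0) • e' k = e' i := by simp
  refine (Submodule.eq_of_le_of_finrank_eq (Submodule.span_le.2 ?_)
    (he'.finrank_span.trans he.finrank_span.symm)).symm
  rintro _ ⟨k, rfl⟩
  obtain ⟨j', hj'i, hj'k⟩ := havoid i k
  refine h.mem_span_of_dual_eq_zero_of_ne hdim he he'
    (b := fun k => if k = i then (1 : ℝ) else 0) (j := j') ?_ ?_ ?_ (by simp [hj'i]) hj'k.symm
  · rw [hsum]; exact hi
  · rw [hsum]; exact he'.mem_closure h.toSharpCone i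
  · rw [hsum]; exact he'.linearIndependent.ne_zero i

/-- If a boundary point in the span of a frame dominates a nonzero point of the closed cone in the
span of another frame, the two spans coincide. -/
lemma span_eq_of_dominated (h : DividedCone C φ δ Γ)
    (hdim : Module.finrank ℝ V = Fintype.card ι + 1) (hcard : 3 ≤ Fintype.card ι)
    (he : IsFrame C e) (he' : IsFrame C e') {p q : V} {ε : ℝ}
    (hp : p ∈ Submodule.span ℝ (range e)) (hpC : p ∈ closure C) (hpn : p ∉ C)
    (hq : q ∈ Submodule.span ℝ (range e')) (hqC : q ∈ closure C) (hq0 : q ≠ 0) (hε : 0 < ε)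
    (hpq : p - ε • q ∈ closure C) :
    Submodule.span ℝ (range e) = Submodule.span ℝ (range e') := by
  classical
  obtain ⟨a, rfl⟩ := Submodule.mem_span_range_iff_exists_fun ℝ |>.1 hp
  have ha := (he.sum_mem_closure_iff h.toSharpCone).1 hpC
  obtain ⟨j, hj⟩ : ∃ j, a j ≤ 0 := by
    by_contra! hall
    exact hpn ((he a).2 hall)
  have haj := le_antisymm hj (ha j)
  obtain ⟨f, hf, hfe⟩ := he.exists_dual h.toSharpCone j
  have h1 := SharpCone.nonneg_of_mem_closure hf hpq
  have h2 := SharpCone.nonneg_of_mem_closure hf hqC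
  have h3 : f (∑ i, a i • e i) = 0 := by simp [map_sum, hfe, haj]
  rw [map_sub, h3, map_smul, smul_eq_mul] at h1
  have hfq : f q = 0 := by nlinarith
  refine h.span_eq_of_common_boundary_point hdim hcard he he'
    (h.mem_span_of_dual_eq_zero hdim he hf hfe hqC hfq) hq hqC (fun hqmem => ?_) hq0
  have := h.eq_zero_of_dual hf hqmem hfq
  simpa [this] using hfe j

end DividedCone

end Rigidity

section Limits

variable {V : Type*} [NormedAddCommGroup V] [NormedSpace ℝ V] [FiniteDimensional ℝ V]
  {ι : Type*} [Fintype ι] {C : Set V} {φ : V →L[ℝ] ℝ} {δ : ℝ}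

lemma exists_norm_one_ker_eq {W : Submodule ℝ V}
    (hW : Module.finrank ℝ V = Module.finrank ℝ W + 1) :
    ∃ η : V →L[ℝ] ℝ, ‖η‖ = 1 ∧ ∀ v, η v = 0 ↔ v ∈ W := by
  have hlt : W < ⊤ := lt_top_iff_ne_top.2 fun htop => by
    rw [htop, finrank_top] at hW; omega
  obtain ⟨f, hf0, hle⟩ := W.exists_le_ker_of_lt_top hlt
  have heq := Submodule.eq_of_le_of_finrank_eq hle (by
    have := Module.Dual.finrank_ker_add_one_of_ne_zero hf0
    omega)
  set F : V →L[ℝ] ℝ := f.toContinuousLinearMap with hF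
  have hF0 : ‖F‖ ≠ 0 := by
    rw [norm_ne_zero_iff]
    intro h0
    exact hf0 (LinearMap.ext fun v => by simpa [hF] using DFunLike.congr_fun h0 v)
  refine ⟨‖F‖⁻¹ • F, by rw [norm_smul, norm_inv, norm_norm, inv_mul_cancel₀ hF0], fun v => ?_⟩
  rw [heq, LinearMap.mem_ker]
  simp [hF, hf0]

/-- A family in the closed cone whose nonnegative combinations exhaust the points of the cone on a
hyperplane meeting the cone is a frame. -/
lemma SharpCone.isFrame_of_ker (h : SharpCone C φ δ)
    (hdim : Module.finrank ℝ V = Fintype.card ι + 1) {a : ι → V} {η : V →L[ℝ] ℝ} (hη : η ≠ 0)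
    (haC : ∀ i, a i ∈ closure C) (haη : ∀ i, η (a i) = 0) {z : V} (hz : z ∈ C) (hzη : η z = 0)
    (hy : ∀ y ∈ C, η y = 0 → ∃ c : ι → ℝ, (∀ i, 0 ≤ c i) ∧ y = ∑ i, c i • a i) :
    IsFrame C a ∧ ∀ v, v ∈ Submodule.span ℝ (range a) ↔ η v = 0 := by
  have hsum : ∀ c : ι → ℝ, ∑ i, c i • a i ∈ Submodule.span ℝ (range a) := fun c =>
    Submodule.sum_mem _ fun i _ => Submodule.smul_mem _ _ (Submodule.subset_span ⟨i, rfl⟩)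
  have hηsum : ∀ c : ι → ℝ, η (∑ i, c i • a i) = 0 := fun c => by simp [map_sum, haη]
  have hspan : Submodule.span ℝ (range a) = LinearMap.ker (η : V →ₗ[ℝ] ℝ) := by
    refine le_antisymm (Submodule.span_le.2 ?_) fun v hv => ?_
    · rintro _ ⟨i, rfl⟩
      exact haη i
    · have hv' : η v = 0 := hv
      obtain ⟨t, ht, htC⟩ := h.exists_pos_add_smul_mem hz v
      obtain ⟨c, -, hc⟩ := hy _ htC (by simp [hzη, hv'])
      obtain ⟨c', -, hc'⟩ := hy _ hz hzη
      have h1 : v = t⁻¹ • ((z + t • v) - z) := by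
        rw [add_sub_cancel_left, smul_smul, inv_mul_cancel₀ ht.ne', one_smul]
      rw [h1, hc]
      refine Submodule.smul_mem _ _ (Submodule.sub_mem _ (hsum _) ?_)
      rw [hc']; exact hsum _
  have hmem : ∀ v, v ∈ Submodule.span ℝ (range a) ↔ η v = 0 := fun v => by rw [hspan]; rfl
  have hli : LinearIndependent ℝ a := by
    rw [linearIndependent_iff_card_eq_finrank_span, Set.finrank, hspan]
    have := Module.Dual.finrank_ker_add_one_of_ne_zero (f := (η : V →ₗ[ℝ] ℝ)) (fun h0 =>
      hη (ContinuousLinearMap.ext fun v => LinearMap.congr_fun h0 v))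
    omega
  have huniq : ∀ c c' : ι → ℝ, ∑ i, c i • a i = ∑ i, c' i • a i → c = c' := fun c c' hcc =>
    hli.fintypeLinearCombination_injective (by simpa [Fintype.linearCombination_apply] using hcc)
  have hnonneg : ∀ c : ι → ℝ, ∑ i, c i • a i ∈ C → ∀ i, 0 ≤ c i := fun c hc => by
    obtain ⟨c', hc', hcc⟩ := hy _ hc (hηsum c)
    rw [huniq _ _ hcc]; exact hc'
  refine ⟨fun c => ⟨fun hc i => ?_, fun hc => ?_⟩, hmem⟩
  · obtain ⟨t, ht, htC⟩ := h.exists_pos_add_smul_mem hc (-∑ i, a i)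
    have h1 : ∑ i, c i • a i + t • -∑ i, a i = ∑ i, (c i - t) • a i := by
      simp only [sub_smul, Finset.sum_sub_distrib, Finset.smul_sum, smul_neg, ← sub_eq_add_neg]
    rw [h1] at htC
    linarith [hnonneg _ htC i]
  · obtain ⟨ζ, -, hζ⟩ := hy _ hz hzη
    have hev : ∀ᶠ t : ℝ in nhdsWithin 0 (Ioi 0), ∀ i, t * ζ i < c i := by
      rw [eventually_all]
      intro i
      have : Tendsto (fun t : ℝ => t * ζ i) (nhds 0) (nhds (0 * ζ i)) :=
        Continuous.tendsto (by fun_prop) 0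
      rw [zero_mul] at this
      exact (this.mono_left nhdsWithin_le_nhds).eventually_lt_const (hc i)
    obtain ⟨t, ht, ht0⟩ := (hev.and self_mem_nhdsWithin).exists
    have h1 : ∑ i, c i • a i = ∑ i, (c i - t * ζ i) • a i + t • z := by
      rw [hζ, Finset.smul_sum, ← Finset.sum_add_distrib]
      refine Finset.sum_congr rfl fun i _ => ?_
      rw [sub_smul, mul_smul]; abel
    rw [h1]
    exact h.closure_add_mem (h.closure_sum_mem _ fun i _ =>
      h.closure_smul_mem (by linarith [ht i]) (haC i)) (h.smul_mem ht0 hz)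

/-- Frames whose slices meet a fixed compact part of the cone subconverge to a frame. -/
theorem SharpCone.exists_frame_limit (h : SharpCone C φ δ)
    (hdim : Module.finrank ℝ V = Fintype.card ι + 1) {A : ℕ → ι → V} (hA : ∀ n, IsFrame C (A n))
    {zs : ℕ → V} (hzs : ∀ n, zs n ∈ Submodule.span ℝ (range (A n))) {z : V}
    (hlim : Tendsto zs atTop (nhds z)) (hz : z ∈ C) :
    ∃ (a : ι → V) (ψ : ℕ → ℕ), IsFrame C a ∧ StrictMono ψ ∧
      (∀ (xs : ℕ → V) (x : V), (∀ n, xs n ∈ Submodule.span ℝ (range (A (ψ n)))) →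
        Tendsto xs atTop (nhds x) → x ∈ Submodule.span ℝ (range a)) ∧
      ∀ y ∈ Submodule.span ℝ (range a), ∃ ys : ℕ → V,
        (∀ n, ys n ∈ Submodule.span ℝ (range (A (ψ n)))) ∧ Tendsto ys atTop (nhds y) := by
  have hAC : ∀ n i, A n i ∈ closure C := fun n i => (hA n).mem_closure h i
  have hφA : ∀ n i, 0 < φ (A n i) := fun n i =>
    h.pos_of_ne_zero (hAC n i) ((hA n).linearIndependent.ne_zero i)
  set B : ℕ → ι → V := fun n i => (φ (A n i))⁻¹ • A n i with hBdef
  have hB : ∀ n, IsFrame C (B n) := fun n => (hA n).pos_smul fun i => inv_pos.2 (hφA n i)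
  have hspanB : ∀ n, Submodule.span ℝ (range (B n)) = Submodule.span ℝ (range (A n)) := fun n =>
    span_range_smul fun i => (inv_pos.2 (hφA n i)).ne'
  have hBC : ∀ n i, B n i ∈ closure C := fun n i => (hB n).mem_closure h i
  have hφB : ∀ n i, φ (B n i) = 1 := fun n i => by
    simp [hBdef, (hφA n i).ne']
  have hBn : ∀ n, ‖B n‖ ≤ δ⁻¹ := fun n =>
    (pi_norm_le_iff_of_nonneg (inv_nonneg.2 h.pos.le)).2 fun i => by
      simpa [hφB] using h.norm_le (hBC n i)
  choose η hη1 hηA using fun n => exists_norm_one_ker_eq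
    (W := Submodule.span ℝ (range (A n))) (by rw [hdim, (hA n).finrank_span])
  obtain ⟨⟨a, ξ⟩, -, ψ, hψ, hlimψ⟩ := tendsto_subseq_of_bounded
    (s := closedBall (0 : ι → V) δ⁻¹ ×ˢ closedBall (0 : V →L[ℝ] ℝ) 1)
    (isBounded_closedBall.prod isBounded_closedBall) (x := fun n => (B n, η n))
    (fun n => ⟨by simpa using hBn n, by simp [hη1 n]⟩)
  have hBa : ∀ i, Tendsto (fun n => B (ψ n) i) atTop (nhds (a i)) := fun i =>
    ((continuous_apply i).tendsto _).comp ((continuous_fst.tendsto _).comp hlimψ)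
  have hηξ : Tendsto (fun n => η (ψ n)) atTop (nhds ξ) := (continuous_snd.tendsto _).comp hlimψ
  have happ : ∀ {v : ℕ → V} {w : V}, Tendsto v atTop (nhds w) →
      Tendsto (fun n => η (ψ n) (v n)) atTop (nhds (ξ w)) := fun {_ w} hv =>
    (isBoundedBilinearMap_apply.continuous.tendsto (ξ, w)).comp (hηξ.prodMk_nhds hv)
  have hclosed : ∀ (xs : ℕ → V) (x : V), (∀ n, xs n ∈ Submodule.span ℝ (range (A (ψ n)))) →
      Tendsto xs atTop (nhds x) → ξ x = 0 := fun xs x hxs hx =>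
    tendsto_nhds_unique (happ hx)
      (tendsto_const_nhds.congr fun n => ((hηA _ _).2 (hxs n)).symm)
  have hξ0 : ξ ≠ 0 := by
    have h1 : ‖ξ‖ = 1 := tendsto_nhds_unique hηξ.norm
      (tendsto_const_nhds.congr fun n => (hη1 _).symm)
    rintro rfl
    simp at h1
  obtain ⟨w, hw⟩ : ∃ w, ξ w ≠ 0 := by
    by_contra! hall
    exact hξ0 (ContinuousLinearMap.ext hall)
  -- points of the limit hyperplane are limits of points of the hyperplanes
  have happrox : ∀ y, ξ y = 0 → ∃ ys : ℕ → V,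
      (∀ n, ys n ∈ Submodule.span ℝ (range (A (ψ n)))) ∧ Tendsto ys atTop (nhds y) := by
    intro y hy
    have hlim1 : Tendsto (fun n => y - (η (ψ n) y / η (ψ n) w) • w) atTop
        (nhds (y - (ξ y / ξ w) • w)) :=
      tendsto_const_nhds.sub (((happ tendsto_const_nhds).div (happ tendsto_const_nhds) hw).smul_const w)
    rw [hy, zero_div, zero_smul, sub_zero] at hlim1
    have hev : ∀ᶠ n in atTop, η (ψ n) w ≠ 0 := (happ (tendsto_const_nhds (x := w))).eventually_ne hw
    classical
    refine ⟨fun n => if η (ψ n) w ≠ 0 then y - (η (ψ n) y / η (ψ n) w) • w else 0,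
      fun n => ?_, hlim1.congr' ?_⟩
    · dsimp only
      split_ifs with hn
      · rw [← hηA]
        simp [div_mul_cancel₀ _ hn]
      · exact Submodule.zero_mem _
    · filter_upwards [hev] with n hn
      rw [if_pos hn]
  have hzξ : ξ z = 0 := hclosed _ z (fun n => hzs (ψ n)) (hlim.comp hψ.tendsto_atTop)
  have haC : ∀ i, a i ∈ closure C := fun i => by
    have := mem_closure_of_tendsto (hBa i) (Eventually.of_forall fun n => hBC _ i)
    rwa [closure_closure] at this
  have haξ : ∀ i, ξ (a i) = 0 := fun i => hclosed _ _ (fun n => by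
    rw [← hspanB]; exact Submodule.subset_span ⟨i, rfl⟩) (hBa i)
  obtain ⟨haF, hspan⟩ := h.isFrame_of_ker hdim hξ0 haC haξ hz hzξ fun y hyC hyξ => by
    obtain ⟨ys, hys, hysy⟩ := happrox y hyξ
    have hc : ∀ n, ∃ c : ι → ℝ, ∑ i, c i • B (ψ n) i = ys n := fun n =>
      Submodule.mem_span_range_iff_exists_fun ℝ |>.1 (by rw [hspanB]; exact hys n)
    choose c hc using hc
    have hφc : ∀ n, ∑ i, c n i = φ (ys n) := fun n => by
      rw [← hc]; simp [map_sum, hφB]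
    have hev : ∀ᶠ n in atTop, c n ∈ Icc (0 : ι → ℝ) (fun _ => φ y + 1) := by
      have h1 : ∀ᶠ n in atTop, φ (ys n) < φ y + 1 :=
        ((φ.continuous.tendsto _).comp hysy).eventually_lt_const (by linarith)
      filter_upwards [h1, hysy.eventually_mem (h.isOpen.mem_nhds hyC)] with n hn hnC
      rw [← hc] at hnC
      have hpos := (hB (ψ n) _).1 hnC
      refine ⟨fun i => (hpos i).le, fun i => ?_⟩
      have := Finset.single_le_sum (fun i _ => (hpos i).le) (Finset.mem_univ i)
      rw [hφc] at this
      exact this.trans hn.le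
    obtain ⟨c', hc', θ, hθ, hcθ⟩ := isCompact_Icc.tendsto_subseq' hev.frequently
    refine ⟨c', fun i => hc'.1 i, ?_⟩
    refine tendsto_nhds_unique (hysy.comp hθ.tendsto_atTop) ?_
    have : Tendsto (fun n => ∑ i, c (θ n) i • B (ψ (θ n)) i) atTop (nhds (∑ i, c' i • a i)) :=
      tendsto_finsetSum _ fun i _ => (((continuous_apply i).tendsto _).comp hcθ).smul
        ((hBa i).comp hθ.tendsto_atTop)
    exact this.congr fun n => hc _
  exact ⟨a, ψ, haF, hψ, fun xs x hxs hx => (hspan x).2 (hclosed xs x hxs hx),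
    fun y hy => happrox y ((hspan y).1 hy)⟩

end Limits

section Isolation

variable {V : Type*} [NormedAddCommGroup V] [NormedSpace ℝ V]
  {C : Set V} {φ : V →L[ℝ] ℝ} {δ : ℝ} {Γ : Subgroup (V ≃ₗ[ℝ] V)}

lemma span_range_comp {ι : Type*} (g : V ≃ₗ[ℝ] V) (e : ι → V) :
    Submodule.span ℝ (range fun i => g (e i)) =
      (Submodule.span ℝ (range e)).map (g : V →ₗ[ℝ] V) := by
  rw [Submodule.map_span, ← range_comp]; rfl

/-- A subspace is near a point when it contains a point comparable to it in the cone order. -/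
def IsNear (C : Set V) (U : Submodule ℝ V) (y : V) : Prop :=
  ∃ q ∈ U, q - (1 / 2 : ℝ) • y ∈ closure C ∧ (2 : ℝ) • y - q ∈ closure C

namespace DividedCone

lemma smul_apply_mem_iff (h : DividedCone C φ δ Γ) {γ : V ≃ₗ[ℝ] V} (hγ : γ ∈ Γ) {t : ℝ}
    (ht : 0 < t) {v : V} : t • γ v ∈ C ↔ v ∈ C := by
  rw [← h.invariant γ hγ v]
  refine ⟨fun hv => ?_, h.smul_mem ht⟩
  simpa [smul_smul, inv_mul_cancel₀ ht.ne'] using h.smul_mem (inv_pos.2 ht) hv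

lemma isFrame_comp {ι : Type*} [Fintype ι] (h : DividedCone C φ δ Γ) {γ : V ≃ₗ[ℝ] V}
    (hγ : γ ∈ Γ) {e : ι → V} (he : IsFrame C e) : IsFrame C fun i => γ (e i) := fun a => by
  rw [← he, ← h.invariant γ hγ (∑ i, a i • e i)]
  simp [map_sum]

/-- If rescaled translates of a sequence converging to a boundary point stay inside the cone, then
the corresponding translates of a fixed interior point leave the cone. -/
lemma notMem_of_tendsto_boundary (h : DividedCone C φ δ Γ) {γ : ℕ → V ≃ₗ[ℝ] V}
    (hγ : ∀ k, γ k ∈ Γ) {t c : ℕ → ℝ} (ht : ∀ k, 0 < t k) {ys : ℕ → V}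
    {p x X Y : V} (hys : Tendsto ys atTop (nhds p)) (hpC : p ∈ closure C) (hpn : p ∉ C)
    (hp0 : p ≠ 0) (hx : x ∈ C) (hX : Tendsto (fun k => c k • γ k x) atTop (nhds X))
    (hY : Tendsto (fun k => t k • γ k (ys k)) atTop (nhds Y)) (hYC : Y ∈ C) : X ∉ C := by
  intro hXC
  obtain ⟨ε, hε, hεC⟩ := h.exists_pos_add_smul_mem hYC (-X)
  obtain ⟨κ, hκ, hκC⟩ := h.exists_pos_add_smul_mem hXC (-Y)
  have hx0 : x ≠ 0 := by
    rintro rfl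
    obtain ⟨s, hs, hsC⟩ := h.exists_pos_add_smul_mem hx (-p)
    refine hp0 (h.eq_zero_of_neg_mem hpC ?_)
    have := h.smul_mem (inv_pos.2 hs) hsC
    rw [zero_add, smul_smul, inv_mul_cancel₀ hs.ne', one_smul] at this
    exact subset_closure this
  have hφx := h.pos_of_ne_zero (subset_closure hx) hx0
  have hφp := h.pos_of_ne_zero hpC hp0
  have e1 := (hY.add (hX.neg.const_smul ε)).eventually_mem (h.isOpen.mem_nhds hεC)
  have e2 := (hX.add (hY.neg.const_smul κ)).eventually_mem (h.isOpen.mem_nhds hκC)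
  have hlim : Tendsto (fun k => ys k - (ε * κ * φ (ys k) / φ x) • x) atTop
      (nhds (p - (ε * κ * φ p / φ x) • x)) :=
    hys.sub ((((φ.continuous.tendsto _).comp hys).const_mul _ |>.div_const _).smul_const _)
  have hmem : p - (ε * κ * φ p / φ x) • x ∈ closure C := by
    refine isClosed_closure.mem_of_tendsto hlim ?_
    filter_upwards [e1, e2] with k h1 h2
    have h1' : ys k - (ε * (c k / t k)) • x ∈ C := by
      rw [← h.smul_apply_mem_iff (hγ k) (ht k)]
      convert h1 using 1
      have := (ht k).ne'
      simp only [map_sub, map_smul]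
      match_scalars <;> field_simp
    have h2' : (c k / t k) • x - κ • ys k ∈ C := by
      rw [← h.smul_apply_mem_iff (hγ k) (ht k)]
      convert h2 using 1
      have := (ht k).ne'
      simp only [map_sub, map_smul]
      match_scalars <;> field_simp
    have h3 := h.nonneg (subset_closure h2')
    rw [map_sub, map_smul, map_smul, smul_eq_mul, smul_eq_mul] at h3
    have h4 : 0 ≤ ε * (c k / t k) - ε * κ * φ (ys k) / φ x := by
      rw [sub_nonneg, div_le_iff₀ hφx]; nlinarith
    have := h.closure_add_closure_mem (subset_closure h1')
      (h.closure_smul_mem h4 (subset_closure hx))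
    convert this using 1
    module
  refine hpn ?_
  have := h.closure_add_mem hmem (h.smul_mem (t := ε * κ * φ p / φ x) (by positivity) hx)
  rwa [sub_add_cancel] at this

variable [FiniteDimensional ℝ V]

lemma smul_apply_mem_closure_iff (h : DividedCone C φ δ Γ) {γ : V ≃ₗ[ℝ] V} (hγ : γ ∈ Γ) {t : ℝ}
    (ht : 0 < t) {v : V} : t • γ v ∈ closure C ↔ v ∈ closure C := by
  have hc : ∀ g : V ≃ₗ[ℝ] V, Continuous g := fun g =>
    (g : V →ₗ[ℝ] V).continuous_of_finiteDimensional
  refine ⟨fun hv => ?_, fun hv => map_mem_closure (f := fun v => t • γ v)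
    ((hc γ).const_smul t) hv fun w hw => (h.smul_apply_mem_iff hγ ht).2 hw⟩
  have := map_mem_closure (f := fun v => t⁻¹ • γ⁻¹ v) ((hc γ⁻¹).const_smul t⁻¹) hv fun w hw =>
    (h.smul_apply_mem_iff (inv_mem hγ) (inv_pos.2 ht)).2 hw
  have h1 : γ⁻¹ (γ v) = v := γ.symm_apply_apply v
  simpa [h1, smul_smul, inv_mul_cancel₀ ht.ne'] using this

end DividedCone

variable [FiniteDimensional ℝ V]

lemma SharpCone.isClosed_setOf_isNear (h : SharpCone C φ δ) (U : Submodule ℝ V) :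
    IsClosed {y | IsNear C U y ∧ y ∈ closure C} := by
  refine IsSeqClosed.isClosed fun ys y hys hy => ?_
  have hyC : y ∈ closure C := isClosed_closure.mem_of_tendsto hy (Eventually.of_forall fun n =>
    (hys n).2)
  choose q hqU hq1 hq2 using fun n => (hys n).1
  have hqC : ∀ n, q n ∈ closure C := fun n => by
    have := h.closure_add_closure_mem (hq1 n)
      (h.closure_smul_mem (t := 1 / 2) (by norm_num) (hys n).2)
    rwa [sub_add_cancel] at this
  obtain ⟨B, hB⟩ := ((φ.continuous.tendsto _).comp hy).bddAbove_range
  have hqB : ∀ n, q n ∈ closedBall (0 : V) (δ⁻¹ * (2 * B)) := fun n => by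
    rw [mem_closedBall_zero_iff]
    refine (h.norm_le (hqC n)).trans ?_
    have h1 := h.nonneg (hq2 n)
    have h2 : φ (ys n) ≤ B := hB ⟨n, rfl⟩
    rw [map_sub, map_smul, smul_eq_mul] at h1
    have := inv_pos.2 h.pos
    gcongr; linarith
  obtain ⟨Q, -, θ, hθ, hQ⟩ := tendsto_subseq_of_bounded isBounded_closedBall hqB
  have hyθ := hy.comp hθ.tendsto_atTop
  refine ⟨⟨Q, U.closed_of_finiteDimensional.mem_of_tendsto hQ (Eventually.of_forall fun n =>
    hqU _), ?_, ?_⟩, hyC⟩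
  · exact isClosed_closure.mem_of_tendsto (hQ.sub (hyθ.const_smul (1 / 2 : ℝ)))
      (Eventually.of_forall fun n => hq1 _)
  · exact isClosed_closure.mem_of_tendsto ((hyθ.const_smul (2 : ℝ)).sub hQ)
      (Eventually.of_forall fun n => hq2 _)

end Isolation

section IsolationTheorem

variable {V : Type*} [NormedAddCommGroup V] [NormedSpace ℝ V] [FiniteDimensional ℝ V]
  {C : Set V} {φ : V →L[ℝ] ℝ} {δ : ℝ} {Γ : Subgroup (V ≃ₗ[ℝ] V)} {ι : Type*} [Fintype ι]
  {e : ι → V}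

namespace DividedCone

/-- A frame whose span is near a nonzero boundary point in the span of another frame has the same
span. -/
lemma span_eq_of_isNear (h : DividedCone C φ δ Γ)
    (hdim : Module.finrank ℝ V = Fintype.card ι + 1) (hcard : 3 ≤ Fintype.card ι) {e' : ι → V}
    (he : IsFrame C e) (he' : IsFrame C e') {p : V} (hp : p ∈ Submodule.span ℝ (range e))
    (hpC : p ∈ closure C) (hpn : p ∉ C) (hp0 : p ≠ 0)
    (hnear : IsNear C (Submodule.span ℝ (range e')) p) :
    Submodule.span ℝ (range e) = Submodule.span ℝ (range e') := by
  obtain ⟨q, hq, hq1, hq2⟩ := hnear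
  have hqC : q ∈ closure C := by
    have := h.closure_add_closure_mem hq1 (h.closure_smul_mem (t := 1 / 2) (by norm_num) hpC)
    rwa [sub_add_cancel] at this
  refine h.span_eq_of_dominated hdim hcard he he' hp hpC hpn hq hqC ?_ (ε := 1 / 2)
    (by norm_num) ?_
  · rintro rfl
    refine hp0 (h.eq_zero_of_neg_mem hpC ?_)
    have := h.closure_smul_mem (t := 2) (by norm_num) hq1
    simpa [smul_smul] using this
  · have := h.closure_smul_mem (t := 1 / 2) (by norm_num) hq2
    rwa [smul_sub, smul_smul, show (1 / 2 : ℝ) * 2 = 1 by norm_num, one_smul] at this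

/-- Along the segment from an interior point `x` to a boundary point `p` of the slice of a frame,
the span of another frame stays near up to some last moment. -/
lemma exists_last_near (h : DividedCone C φ δ Γ) {U : Submodule ℝ V} {x p : V}
    (hx : x ∈ C) (hp : p ∈ closure C) (hpU : ¬ IsNear C U p) {s₀ : ℝ} (hs₀ : s₀ ∈ Ico (0 : ℝ) 1)
    (hnear : IsNear C U ((1 - s₀) • x + s₀ • p)) :
    ∃ σ, s₀ ≤ σ ∧ σ < 1 ∧ IsNear C U ((1 - σ) • x + σ • p) ∧
      ∀ s, σ < s → s < 1 → ¬ IsNear C U ((1 - s) • x + s • p) := by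
  have hcl : ∀ s ∈ Icc (0 : ℝ) 1, (1 - s) • x + s • p ∈ closure C := fun s hs =>
    h.closure_add_closure_mem (h.closure_smul_mem (by linarith [hs.2]) (subset_closure hx))
      (h.closure_smul_mem hs.1 hp)
  have hcomp : IsCompact (Icc (0 : ℝ) 1 ∩ {s : ℝ | IsNear C U ((1 - s) • x + s • p) ∧
      (1 - s) • x + s • p ∈ closure C}) :=
    isCompact_Icc.inter_right ((h.isClosed_setOf_isNear U).preimage
      (f := fun s : ℝ => (1 - s) • x + s • p) (by fun_prop))
  have hs₀' : s₀ ∈ Icc (0 : ℝ) 1 := ⟨hs₀.1, hs₀.2.le⟩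
  obtain ⟨σ, ⟨hσ, hσn, -⟩, hmax⟩ := hcomp.exists_isGreatest ⟨s₀, hs₀', hnear, hcl _ hs₀'⟩
  have hσs : s₀ ≤ σ := hmax ⟨hs₀', hnear, hcl _ hs₀'⟩
  refine ⟨σ, hσs, lt_of_le_of_ne hσ.2 ?_, hσn, fun s hs hs1 hsn => ?_⟩
  · rintro rfl
    exact hpU (by simpa using hσn)
  · have hs' : s ∈ Icc (0 : ℝ) 1 := ⟨hσ.1.trans hs.le, hs1.le⟩
    exact hs.not_ge (hmax ⟨hs', hsn, hcl s hs'⟩)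

/-- Frames with spans different from a given one do not accumulate on it. -/
theorem false_of_tendsto_frame (h : DividedCone C φ δ Γ)
    (hdim : Module.finrank ℝ V = Fintype.card ι + 1) (hcard : 3 ≤ Fintype.card ι)
    (he : IsFrame C e) {E : ℕ → ι → V} (hE : ∀ n, IsFrame C (E n))
    (hne : ∀ n, Submodule.span ℝ (range (E n)) ≠ Submodule.span ℝ (range e))
    (happ : ∀ y ∈ C, y ∈ Submodule.span ℝ (range e) → ∃ zs : ℕ → V,
      (∀ n, zs n ∈ Submodule.span ℝ (range (E n))) ∧ Tendsto zs atTop (nhds y)) : False := by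
  have hS := h.toSharpCone
  obtain ⟨i₀, i₁, hi⟩ : ∃ i₀ i₁ : ι, i₀ ≠ i₁ := Fintype.one_lt_card_iff.1 (by omega)
  set x := ∑ i, e i with hxdef
  set p := e i₀ with hpdef
  have hxC : x ∈ C := he.sum_mem
  have hxe : x ∈ Submodule.span ℝ (range e) :=
    Submodule.sum_mem _ fun i _ => Submodule.subset_span ⟨i, rfl⟩
  have hpe : p ∈ Submodule.span ℝ (range e) := Submodule.subset_span ⟨i₀, rfl⟩
  have hpC : p ∈ closure C := he.mem_closure hS i₀
  have hp0 : p ≠ 0 := he.linearIndependent.ne_zero i₀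
  have hpn : p ∉ C := fun hmem => by
    classical
    have := (he (fun i => if i = i₀ then 1 else 0)).1 (by simpa using hmem) i₁
    simp [hi.symm] at this
  have hx0 : x ≠ 0 := fun h0 => by
    have := Fintype.linearIndependent_iff.1 he.linearIndependent (fun _ => 1)
      (by simpa [hxdef] using h0) i₀
    simp at this
  have hfar : ∀ n, ¬ IsNear C (Submodule.span ℝ (range (E n))) p := fun n hnear =>
    hne n (h.span_eq_of_isNear hdim hcard he (hE n) hpe hpC hpn hp0 hnear).symm
  have hnear : ∀ v ∈ C, v ∈ Submodule.span ℝ (range e) →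
      ∀ᶠ n in atTop, IsNear C (Submodule.span ℝ (range (E n))) v := by
    intro v hv hve
    obtain ⟨zs, hzs, hlim⟩ := happ v hv hve
    have h1 : Tendsto (fun n => zs n - (1 / 2 : ℝ) • v) atTop (nhds (v - (1 / 2 : ℝ) • v)) :=
      hlim.sub_const _
    have h2 : Tendsto (fun n => (2 : ℝ) • v - zs n) atTop (nhds ((2 : ℝ) • v - v)) :=
      hlim.const_sub _
    have m1 : v - (1 / 2 : ℝ) • v ∈ C := by
      rw [show v - (1 / 2 : ℝ) • v = (1 / 2 : ℝ) • v by module]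
      exact h.smul_mem (by norm_num) hv
    have m2 : (2 : ℝ) • v - v ∈ C := by
      rwa [show (2 : ℝ) • v - v = v by module]
    filter_upwards [h1.eventually_mem (h.isOpen.mem_nhds m1),
      h2.eventually_mem (h.isOpen.mem_nhds m2)] with n hn1 hn2
    exact ⟨zs n, hzs n, subset_closure hn1, subset_closure hn2⟩
  set y : ℝ → V := fun s => (1 - s) • x + s • p with hydef
  have hycont : Continuous y := by fun_prop
  have hyC : ∀ s, 0 ≤ s → s < 1 → y s ∈ C := fun s hs0 hs1 =>
    h.add_closure_mem (h.smul_mem (by linarith) hxC) (h.closure_smul_mem hs0 hpC)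
  have hye : ∀ s, y s ∈ Submodule.span ℝ (range e) := fun s =>
    Submodule.add_mem _ (Submodule.smul_mem _ _ hxe) (Submodule.smul_mem _ _ hpe)
  -- the last parameters at which the given spans are near
  have hlast : ∀ k : ℕ, ∃ n σ, 1 - ((k : ℝ) + 1)⁻¹ ≤ σ ∧ 0 ≤ σ ∧ σ < 1 ∧
      IsNear C (Submodule.span ℝ (range (E n))) x ∧
      IsNear C (Submodule.span ℝ (range (E n))) (y σ) ∧
      ∀ s, σ < s → s < 1 → ¬ IsNear C (Submodule.span ℝ (range (E n))) (y s) := by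
    intro k
    have hk : (0 : ℝ) < ((k : ℝ) + 1)⁻¹ := by positivity
    have hk1 : ((k : ℝ) + 1)⁻¹ ≤ 1 := inv_le_one_of_one_le₀ (by linarith [k.cast_nonneg (α := ℝ)])
    have hs₀ : 1 - ((k : ℝ) + 1)⁻¹ ∈ Ico (0 : ℝ) 1 := ⟨by linarith, by linarith⟩
    obtain ⟨n, hn1, hn2⟩ := ((hnear x hxC hxe).and
      (hnear _ (hyC _ hs₀.1 hs₀.2) (hye _))).exists
    obtain ⟨σ, h1, h2, h3, h4⟩ := h.exists_last_near hxC hpC (hfar n) hs₀ hn2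
    exact ⟨n, σ, h1, hs₀.1.trans h1, h2, hn1, h3, h4⟩
  choose N σ hσ hσ0 hσ1 hxnear hynear hmax using hlast
  choose r hrU hr1 hr2 using hxnear
  choose q hqU hq1 hq2 using hynear
  have hσlim : Tendsto σ atTop (nhds 1) := by
    have : Tendsto (fun k : ℕ => 1 - ((k : ℝ) + 1)⁻¹) atTop (nhds (1 - 0)) :=
      tendsto_const_nhds.sub (tendsto_inv_atTop_zero.comp
        (tendsto_atTop_add_const_right _ _ tendsto_natCast_atTop_atTop))
    rw [sub_zero] at this
    exact tendsto_of_tendsto_of_tendsto_of_le_of_le this tendsto_const_nhds hσ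
      fun k => (hσ1 k).le
  have hylim : Tendsto (fun k => y (σ k)) atTop (nhds p) := by
    have := (hycont.tendsto 1).comp hσlim
    simpa [hydef, Function.comp_def] using this
  -- renormalize
  obtain ⟨K, hKC, hK, hcov⟩ := h.cocompact
  choose γ hγ t ht hYK using fun k => hcov (y (σ k)) (hyC _ (hσ0 k) (hσ1 k))
  have hγx : ∀ k, γ k x ∈ C := fun k => (h.invariant _ (hγ k) x).2 hxC
  have hφγx : ∀ k, 0 < φ (γ k x) := fun k => h.pos_of_ne_zero (subset_closure (hγx k))
    (by simpa using hx0)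
  set c : ℕ → ℝ := fun k => (φ (γ k x))⁻¹ with hcdef
  have hc : ∀ k, 0 < c k := fun k => inv_pos.2 (hφγx k)
  set X : ℕ → V := fun k => c k • γ k x with hXdef
  set Y : ℕ → V := fun k => t k • γ k (y (σ k)) with hYdef
  set Q : ℕ → V := fun k => t k • γ k (q k) with hQdef
  set R : ℕ → V := fun k => c k • γ k (r k) with hRdef
  have hXC : ∀ k, X k ∈ closure C := fun k => subset_closure (h.smul_mem (hc k) (hγx k))
  have hφX : ∀ k, φ (X k) = 1 := fun k => by simp [hXdef, hcdef, (hφγx k).ne']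
  have hYC : ∀ k, Y k ∈ closure C := fun k => subset_closure (hKC (hYK k))
  have hQ1 : ∀ k, Q k - (1 / 2 : ℝ) • Y k ∈ closure C := fun k => by
    convert (h.smul_apply_mem_closure_iff (hγ k) (ht k)).2 (hq1 k) using 1
    simp only [hQdef, hYdef, map_sub, map_smul]; module
  have hQ2 : ∀ k, (2 : ℝ) • Y k - Q k ∈ closure C := fun k => by
    convert (h.smul_apply_mem_closure_iff (hγ k) (ht k)).2 (hq2 k) using 1
    simp only [hQdef, hYdef, map_sub, map_smul]; module
  have hR1 : ∀ k, R k - (1 / 2 : ℝ) • X k ∈ closure C := fun k => by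
    convert (h.smul_apply_mem_closure_iff (hγ k) (hc k)).2 (hr1 k) using 1
    simp only [hRdef, hXdef, map_sub, map_smul]; module
  have hR2 : ∀ k, (2 : ℝ) • X k - R k ∈ closure C := fun k => by
    convert (h.smul_apply_mem_closure_iff (hγ k) (hc k)).2 (hr2 k) using 1
    simp only [hRdef, hXdef, map_sub, map_smul]; module
  obtain ⟨M, hM⟩ := hK.bddAbove_image φ.continuous.continuousOn
  have hbound : ∀ {u w : ℕ → V} {B : ℝ}, (∀ k, u k - (1 / 2 : ℝ) • w k ∈ closure C) →
      (∀ k, (2 : ℝ) • w k - u k ∈ closure C) → (∀ k, w k ∈ closure C) → (∀ k, φ (w k) ≤ B) →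
      ∀ k, u k ∈ closedBall (0 : V) (δ⁻¹ * (2 * B)) := fun {u w B} h1 h2 h3 h4 k => by
    have hu : u k ∈ closure C := by
      have := h.closure_add_closure_mem (h1 k)
        (h.closure_smul_mem (t := 1 / 2) (by norm_num) (h3 k))
      rwa [sub_add_cancel] at this
    rw [mem_closedBall_zero_iff]
    refine (h.norm_le hu).trans ?_
    have h5 := h.nonneg (h2 k)
    have h6 := h4 k
    rw [map_sub, map_smul, smul_eq_mul] at h5
    have := inv_pos.2 h.pos
    gcongr; linarith
  obtain ⟨⟨X', Y', Q', R'⟩, -, θ, hθ, hlim⟩ := tendsto_subseq_of_bounded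
    (s := closedBall (0 : V) δ⁻¹ ×ˢ K ×ˢ closedBall (0 : V) (δ⁻¹ * (2 * M)) ×ˢ
      closedBall (0 : V) (δ⁻¹ * (2 * 1)))
    (isBounded_closedBall.prod (hK.isBounded.prod (isBounded_closedBall.prod
      isBounded_closedBall))) (x := fun k => (X k, Y k, Q k, R k))
    (fun k => ⟨by simpa [hφX] using h.norm_le (hXC k), hYK k,
      hbound hQ1 hQ2 hYC (fun k => hM ⟨_, hYK k, rfl⟩) k,
      hbound hR1 hR2 hXC (fun k => (hφX k).le) k⟩)
  have hX : Tendsto (fun k => X (θ k)) atTop (nhds X') := (continuous_fst.tendsto _).comp hlim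
  have hY : Tendsto (fun k => Y (θ k)) atTop (nhds Y') :=
    (continuous_fst.tendsto _).comp ((continuous_snd.tendsto _).comp hlim)
  have hQ : Tendsto (fun k => Q (θ k)) atTop (nhds Q') := (continuous_fst.tendsto _).comp
    ((continuous_snd.tendsto _).comp ((continuous_snd.tendsto _).comp hlim))
  have hR : Tendsto (fun k => R (θ k)) atTop (nhds R') := (continuous_snd.tendsto _).comp
    ((continuous_snd.tendsto _).comp ((continuous_snd.tendsto _).comp hlim))
  have hY'C : Y' ∈ C := hKC (hK.isClosed.mem_of_tendsto hY (Eventually.of_forall fun k => hYK _))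
  have hQ'C : Q' ∈ C := by
    have h1 : Q' - (1 / 2 : ℝ) • Y' ∈ closure C := isClosed_closure.mem_of_tendsto
      (hQ.sub (hY.const_smul _)) (Eventually.of_forall fun k => hQ1 _)
    have := h.closure_add_mem h1 (h.smul_mem (t := 1 / 2) (by norm_num) hY'C)
    rwa [sub_add_cancel] at this
  have hX'C : X' ∈ closure C := isClosed_closure.mem_of_tendsto hX
    (Eventually.of_forall fun k => hXC _)
  have hX'0 : X' ≠ 0 := by
    have h1 : φ X' = 1 := tendsto_nhds_unique ((φ.continuous.tendsto _).comp hX)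
      (tendsto_const_nhds.congr fun k => (hφX _).symm)
    rintro rfl
    simp at h1
  have hX'n : X' ∉ C := h.notMem_of_tendsto_boundary (fun k => hγ (θ k)) (fun k => ht (θ k))
    (hylim.comp hθ.tendsto_atTop) hpC hpn hp0 hxC hX hY hY'C
  -- limits of the two families of frames
  have hmap : ∀ k (f : ι → V) (s : ℝ) {v : V}, v ∈ Submodule.span ℝ (range f) →
      s • γ k v ∈ Submodule.span ℝ (range fun i => γ k (f i)) := fun k f s v hv => by
    rw [span_range_comp]
    exact Submodule.smul_mem _ _ (Submodule.mem_map_of_mem hv)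
  obtain ⟨a, ψ, ha, hψ, haX, -⟩ := hS.exists_frame_limit hdim
    (A := fun k i => γ (θ k) (e i)) (fun k => h.isFrame_comp (hγ _) he)
    (fun k => hmap (θ k) e (t (θ k)) (hye _)) hY hY'C
  obtain ⟨a', ψ', ha', hψ', haR, haW⟩ := hS.exists_frame_limit hdim
    (A := fun k i => γ (θ (ψ k)) (E (N (θ (ψ k))) i)) (fun k => h.isFrame_comp (hγ _) (hE _))
    (fun k => hmap (θ (ψ k)) _ (t (θ (ψ k))) (hqU _)) (hQ.comp hψ.tendsto_atTop) hQ'C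
  have hX'a : X' ∈ Submodule.span ℝ (range a) := haX (fun k => X (θ (ψ k))) _
    (fun k => hmap _ e _ hxe) (hX.comp hψ.tendsto_atTop)
  have hY'a : Y' ∈ Submodule.span ℝ (range a) := haX (fun k => Y (θ (ψ k))) _
    (fun k => hmap _ e _ (hye _)) (hY.comp hψ.tendsto_atTop)
  have hR'a : R' ∈ Submodule.span ℝ (range a') := haR (fun k => R (θ (ψ (ψ' k)))) _
    (fun k => hmap _ _ _ (hrU _)) (hR.comp (hψ.tendsto_atTop.comp hψ'.tendsto_atTop))
  have hspan : Submodule.span ℝ (range a) = Submodule.span ℝ (range a') :=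
    h.span_eq_of_isNear hdim hcard ha ha' hX'a hX'C hX'n hX'0 ⟨R', hR'a,
      isClosed_closure.mem_of_tendsto (hR.sub (hX.const_smul _))
        (Eventually.of_forall fun k => hR1 _),
      isClosed_closure.mem_of_tendsto ((hX.const_smul _).sub hR)
        (Eventually.of_forall fun k => hR2 _)⟩
  rw [hspan] at hY'a
  obtain ⟨W, hW, hWY⟩ := haW _ hY'a
  have hYW := hY.comp (hψ.tendsto_atTop.comp hψ'.tendsto_atTop)
  have m1 : Y' - (1 / 2 : ℝ) • Y' ∈ C := by
    rw [show Y' - (1 / 2 : ℝ) • Y' = (1 / 2 : ℝ) • Y' by module]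
    exact h.smul_mem (by norm_num) hY'C
  have m2 : (2 : ℝ) • Y' - Y' ∈ C := by
    rwa [show (2 : ℝ) • Y' - Y' = Y' by module]
  obtain ⟨k, hk1, hk2⟩ := (((hWY.sub (hYW.const_smul (1 / 2 : ℝ))).eventually_mem
    (h.isOpen.mem_nhds m1)).and (((hYW.const_smul (2 : ℝ)).sub hWY).eventually_mem
    (h.isOpen.mem_nhds m2))).exists
  have hWk := hW k
  change W k - (1 / 2 : ℝ) • Y (θ (ψ (ψ' k))) ∈ C at hk1
  change (2 : ℝ) • Y (θ (ψ (ψ' k))) - W k ∈ C at hk2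
  generalize θ (ψ (ψ' k)) = m at hk1 hk2 hWk
  rw [span_range_comp] at hWk
  obtain ⟨w, hw, hwW⟩ := hWk
  have hwW' : W k = t m • γ m ((t m)⁻¹ • w) := by
    rw [map_smul, smul_smul, mul_inv_cancel₀ (ht m).ne', one_smul]; exact hwW.symm
  rw [hwW'] at hk1 hk2
  have hw1 : (t m)⁻¹ • w - (1 / 2 : ℝ) • y (σ m) ∈ C := by
    rw [← h.smul_apply_mem_iff (hγ m) (ht m)]
    convert hk1 using 1
    simp only [hYdef, map_sub, map_smul]; module
  have hw2 : (2 : ℝ) • y (σ m) - (t m)⁻¹ • w ∈ C := by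
    rw [← h.smul_apply_mem_iff (hγ m) (ht m)]
    convert hk2 using 1
    simp only [hYdef, map_sub, map_smul]; module
  have ho1 : IsOpen {s : ℝ | (t m)⁻¹ • w - (1 / 2 : ℝ) • y s ∈ C} :=
    h.isOpen.preimage (by fun_prop)
  have ho2 : IsOpen {s : ℝ | (2 : ℝ) • y s - (t m)⁻¹ • w ∈ C} :=
    h.isOpen.preimage (by fun_prop)
  have hev : ∀ᶠ s in nhdsWithin (σ m) (Ioo (σ m) 1),
      (t m)⁻¹ • w - (1 / 2 : ℝ) • y s ∈ C ∧ (2 : ℝ) • y s - (t m)⁻¹ • w ∈ C :=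
    nhdsWithin_le_nhds (inter_mem (ho1.mem_nhds hw1) (ho2.mem_nhds hw2))
  have : (nhdsWithin (σ m) (Ioo (σ m) 1)).NeBot := left_nhdsWithin_Ioo_neBot (hσ1 m)
  obtain ⟨s, ⟨hs1, hs2⟩, hs⟩ := (hev.and self_mem_nhdsWithin).exists
  exact hmax m s hs.1 hs.2 ⟨_, Submodule.smul_mem _ _ hw, subset_closure hs1, subset_closure hs2⟩

end DividedCone

end IsolationTheorem

section Finiteness

variable {V : Type*} [NormedAddCommGroup V] [NormedSpace ℝ V] [FiniteDimensional ℝ V]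
  {C : Set V} {φ : V →L[ℝ] ℝ} {δ : ℝ} {Γ : Subgroup (V ≃ₗ[ℝ] V)} {ι : Type*} [Fintype ι]
  {e : ι → V}

namespace DividedCone

/-- Frames with pairwise distinct spans do not accumulate on a frame. -/
theorem false_of_injective_frames (h : DividedCone C φ δ Γ)
    (hdim : Module.finrank ℝ V = Fintype.card ι + 1) (hcard : 3 ≤ Fintype.card ι)
    (he : IsFrame C e) {E : ℕ → ι → V} (hE : ∀ n, IsFrame C (E n))
    (hinj : Function.Injective fun n => Submodule.span ℝ (range (E n)))
    (happ : ∀ y ∈ C, y ∈ Submodule.span ℝ (range e) → ∃ zs : ℕ → V,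
      (∀ n, zs n ∈ Submodule.span ℝ (range (E n))) ∧ Tendsto zs atTop (nhds y)) : False := by
  obtain ⟨N, hN⟩ : ∃ N, ∀ n,
      Submodule.span ℝ (range (E (n + N))) ≠ Submodule.span ℝ (range e) := by
    by_cases hex : ∃ n₀, Submodule.span ℝ (range (E n₀)) = Submodule.span ℝ (range e)
    · obtain ⟨n₀, hn₀⟩ := hex
      refine ⟨n₀ + 1, fun n hn => ?_⟩
      have := hinj (hn.trans hn₀.symm)
      omega
    · exact ⟨0, fun n hn => hex ⟨_, hn⟩⟩
  refine h.false_of_tendsto_frame hdim hcard he (fun n => hE (n + N)) hN fun y hy hye => ?_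
  obtain ⟨zs, hzs, hlim⟩ := happ y hy hye
  exact ⟨fun n => zs (n + N), fun n => hzs _, hlim.comp (tendsto_add_atTop_nat N)⟩

/-- Only finitely many spans of frames meet a compact subset of the cone. -/
theorem finite_spans_meeting_compact (h : DividedCone C φ δ Γ)
    (hdim : Module.finrank ℝ V = Fintype.card ι + 1) (hcard : 3 ≤ Fintype.card ι)
    {K : Set V} (hKC : K ⊆ C) (hK : IsCompact K) :
    {P : Submodule ℝ V | (∃ f : ι → V, IsFrame C f ∧ Submodule.span ℝ (range f) = P) ∧
      ∃ z ∈ K, z ∈ P}.Finite := by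
  by_contra hinf
  rw [← Set.Infinite] at hinf
  have hmem := fun n => (hinf.natEmbedding _ n).2
  choose f hf hfP using fun n => (hmem n).1
  choose z hzK hzP using fun n => (hmem n).2
  obtain ⟨z', hz', θ, hθ, hlim⟩ := hK.tendsto_subseq hzK
  obtain ⟨a, ψ, ha, hψ, -, happ⟩ := h.exists_frame_limit hdim (A := fun n => f (θ n))
    (fun n => hf _) (zs := fun n => z (θ n)) (fun n => by rw [hfP]; exact hzP _) hlim (hKC hz')
  refine h.false_of_injective_frames hdim hcard ha (fun n => hf (θ (ψ n))) (fun m n hmn => ?_)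
    fun y _ hy => happ y hy
  dsimp only at hmn
  rw [hfP, hfP] at hmn
  exact hψ.injective (hθ.injective ((hinf.natEmbedding _).injective (Subtype.ext hmn)))

end DividedCone

end Finiteness

section Simplices

variable {ι : Type*} [Fintype ι] {E : Type*} [NormedAddCommGroup E] [NormedSpace ℝ E]

lemma sum_smul_prod_one (v : ι → E) (w : ι → ℝ) :
    ∑ i, w i • (v i, (1 : ℝ)) = (∑ i, w i • v i, ∑ i, w i) := by
  simp [Prod.ext_iff, Prod.fst_sum, Prod.snd_sum]

lemma mem_convexHull_range_iff {v : ι → E} {x : E} :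
    x ∈ convexHull ℝ (range v) ↔
      ∃ w : ι → ℝ, (∀ i, 0 ≤ w i) ∧ ∑ i, w i • (v i, (1 : ℝ)) = (x, 1) := by
  classical
  constructor
  · intro hx
    refine convexHull_min (t := {x : E | ∃ w : ι → ℝ, (∀ i, 0 ≤ w i) ∧
      ∑ i, w i • (v i, (1 : ℝ)) = (x, 1)}) ?_ ?_ hx
    · rintro _ ⟨i, rfl⟩
      exact ⟨fun j => if j = i then 1 else 0, fun j => by positivity, by simp⟩
    · rintro x ⟨w, hw, hwx⟩ y ⟨w', hw', hwy⟩ a b ha hb hab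
      refine ⟨fun i => a * w i + b * w' i, fun i =>
        add_nonneg (mul_nonneg ha (hw i)) (mul_nonneg hb (hw' i)), ?_⟩
      simp only [add_smul, mul_smul, Finset.sum_add_distrib, ← Finset.smul_sum, hwx, hwy]
      simp [hab]
  · rintro ⟨w, hw, hwx⟩
    rw [sum_smul_prod_one, Prod.mk.injEq] at hwx
    rw [← hwx.1]
    exact (convex_convexHull ℝ _).sum_mem (fun i _ => hw i) hwx.2
      fun i _ => subset_convexHull ℝ _ ⟨i, rfl⟩

lemma AffineIndependent.linearIndependent_prod_one {v : ι → E} (hv : AffineIndependent ℝ v) :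
    LinearIndependent ℝ fun i => (v i, (1 : ℝ)) := by
  rw [Fintype.linearIndependent_iff]
  intro w hw i
  rw [sum_smul_prod_one, Prod.mk_eq_zero] at hw
  exact affineIndependent_iff.1 hv Finset.univ w hw.2 hw.1 i (Finset.mem_univ i)

/-- The intrinsic interior of a simplex consists of the combinations with positive weights. -/
lemma AffineIndependent.mem_intrinsicInterior_iff [FiniteDimensional ℝ E] [Nonempty ι]
    {v : ι → E} (hv : AffineIndependent ℝ v) {x : E} :
    x ∈ intrinsicInterior ℝ (convexHull ℝ (range v)) ↔
      ∃ w : ι → ℝ, (∀ i, 0 < w i) ∧ ∑ i, w i • (v i, (1 : ℝ)) = (x, 1) := by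
  obtain ⟨G, hG⟩ := (Fintype.linearCombination ℝ fun i => (v i, (1 : ℝ))).exists_leftInverse_of_injective
    (LinearMap.ker_eq_bot.2 hv.linearIndependent_prod_one.fintypeLinearCombination_injective)
  have hGw : ∀ w : ι → ℝ, G (∑ i, w i • (v i, (1 : ℝ))) = w := fun w => LinearMap.congr_fun hG w
  have hGc : Continuous G := G.continuous_of_finiteDimensional
  have hspan : ∀ y ∈ affineSpan ℝ (range v), ∃ w : ι → ℝ,
      ∑ i, w i • (v i, (1 : ℝ)) = (y, 1) := fun y hy => by
    obtain ⟨w, hw, rfl⟩ := eq_affineCombination_of_mem_affineSpan_of_fintype hy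
    refine ⟨w, ?_⟩
    rw [sum_smul_prod_one, hw, Finset.affineCombination_eq_linear_combination _ _ _ hw]
  rw [mem_intrinsicInterior]
  constructor
  · rintro ⟨y, hy, rfl⟩
    have hyspan : (y : E) ∈ affineSpan ℝ (range v) := affineSpan_convexHull (𝕜 := ℝ) (range v) ▸ y.2
    obtain ⟨w, hw⟩ := hspan y hyspan
    refine ⟨w, fun i => ?_, hw⟩
    have hcard : (0 : ℝ) < Fintype.card ι := by exact_mod_cast Fintype.card_pos
    set c : E := ∑ j, (Fintype.card ι : ℝ)⁻¹ • v j with hc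
    have hcw : ∑ j : ι, (Fintype.card ι : ℝ)⁻¹ • (v j, (1 : ℝ)) = (c, 1) := by
      rw [sum_smul_prod_one]
      simp [hc, hcard.ne']
    have hcspan : c ∈ affineSpan ℝ (convexHull ℝ (range v)) :=
      subset_affineSpan ℝ _ (mem_convexHull_range_iff.2 ⟨_, fun _ => by positivity, hcw⟩)
    set L : ℝ → affineSpan ℝ (convexHull ℝ (range v)) := fun t =>
      ⟨AffineMap.lineMap c (y : E) (1 + t), AffineMap.lineMap_mem _ hcspan y.2⟩ with hL
    have hLc : Continuous L := by
      refine Continuous.subtype_mk ?_ _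
      simp only [AffineMap.lineMap_apply_module]
      fun_prop
    have hL0 : L 0 = y := Subtype.ext (by simp [hL])
    have hev : ∀ᶠ t in nhdsWithin (0 : ℝ) (Ioi 0),
        L t ∈ ((↑) ⁻¹' convexHull ℝ (range v) : Set (affineSpan ℝ (convexHull ℝ (range v)))) :=
      nhdsWithin_le_nhds (hLc.continuousAt.preimage_mem_nhds
        (by rw [hL0]; exact mem_interior_iff_mem_nhds.1 hy))
    obtain ⟨t, htm, ht⟩ := (hev.and self_mem_nhdsWithin).exists
    have ht' : (0 : ℝ) < t := ht
    obtain ⟨w', hw', hw't⟩ := mem_convexHull_range_iff.1 htm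
    have heq : ((L t : E), (1 : ℝ)) = (1 + t) • ((y : E), (1 : ℝ)) - t • (c, (1 : ℝ)) := by
      simp [hL, AffineMap.lineMap_apply_module]
      module
    have := congrArg G (hw't.trans heq)
    rw [map_sub, map_smul, map_smul, ← hw, ← hcw, hGw, hGw, hGw] at this
    have hi := congrFun this i
    simp only [Pi.sub_apply, Pi.smul_apply, smul_eq_mul] at hi
    have h1 := hw' i
    have h2 : 0 < t * (Fintype.card ι : ℝ)⁻¹ := by positivity
    have h3 : 0 < (1 + t) * w i := by linarith
    exact pos_of_mul_pos_right h3 (by linarith)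
  · rintro ⟨w, hw, hwx⟩
    have hx : x ∈ affineSpan ℝ (convexHull ℝ (range v)) :=
      subset_affineSpan ℝ _ (mem_convexHull_range_iff.2 ⟨w, fun i => (hw i).le, hwx⟩)
    refine ⟨⟨x, hx⟩, ?_, rfl⟩
    have hO : IsOpen {y : affineSpan ℝ (convexHull ℝ (range v)) |
        ∀ i, 0 < G ((y : E), (1 : ℝ)) i} := by
      simp only [ofPred_forall]
      exact isOpen_iInter_of_finite fun i => isOpen_lt continuous_const
        ((continuous_apply i).comp (hGc.comp (by fun_prop)))
    refine interior_maximal ?_ hO fun i => ?_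
    · intro y hy
      obtain ⟨w', hw'⟩ := hspan y (affineSpan_convexHull (𝕜 := ℝ) (range v) ▸ y.2)
      refine mem_convexHull_range_iff.2 ⟨w', fun i => ?_, hw'⟩
      have := hy i
      rw [← hw', hGw] at this
      exact this.le
    · change 0 < G (x, 1) i
      rw [← hwx, hGw]; exact hw i

end Simplices

section Domains

variable {d : ℕ} {Ω : Set (Euc d)}

lemma mem_coneOver_iff {p : Euc d × ℝ} : p ∈ coneOver Ω ↔ 0 < p.2 ∧ p.2⁻¹ • p.1 ∈ Ω := by
  constructor
  · rintro ⟨t, ht, x, hx, rfl⟩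
    simpa [smul_smul, ht.ne', ht] using hx
  · rintro ⟨hp, hx⟩
    exact ⟨p.2, hp, _, hx, by simp [smul_smul, hp.ne']⟩

lemma prod_one_mem_coneOver_iff {x : Euc d} : (x, (1 : ℝ)) ∈ coneOver Ω ↔ x ∈ Ω := by
  simp [mem_coneOver_iff]

lemma exists_sharpCone_coneOver (hne : Ω.Nonempty) (hbd : Bornology.IsBounded Ω)
    (hop : IsOpen Ω) (hconv : Convex ℝ Ω) :
    ∃ δ, SharpCone (coneOver Ω) (ContinuousLinearMap.snd ℝ (Euc d) ℝ) δ := by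
  obtain ⟨R, hR1, hR⟩ := hbd.exists_pos_norm_le
  refine ⟨(max R 1)⁻¹, ?_, ?_, ?_, ?_, by positivity, ?_⟩
  · have hc : ContinuousOn
        (fun p : Euc d × ℝ => p.2⁻¹ • p.1) {p : Euc d × ℝ | 0 < p.2} :=
      ContinuousOn.smul (f := fun p : Euc d × ℝ => p.2⁻¹)
        (continuousOn_snd.inv₀ fun p hp => (show 0 < p.2 from hp).ne') continuousOn_fst
    have := hc.isOpen_inter_preimage (isOpen_lt continuous_const continuous_snd) hop
    rwa [show coneOver Ω = {p | 0 < p.2} ∩ (fun p : Euc d × ℝ => p.2⁻¹ • p.1) ⁻¹' Ω from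
      Set.ext fun p => mem_coneOver_iff]
  · obtain ⟨x, hx⟩ := hne
    exact ⟨_, prod_one_mem_coneOver_iff.2 hx⟩
  · rintro _ _ ⟨s, hs, x, hx, rfl⟩ ⟨t, ht, y, hy, rfl⟩
    have hst : 0 < s + t := by positivity
    refine ⟨s + t, hst, _, hconv hx hy (a := s / (s + t)) (b := t / (s + t)) (by positivity)
      (by positivity) (by field_simp), ?_⟩
    simp [smul_smul, mul_div_cancel₀ _ hst.ne']
  · rintro s _ hs ⟨t, ht, x, hx, rfl⟩
    exact ⟨s * t, by positivity, x, hx, smul_smul ..⟩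
  · rintro _ ⟨t, ht, x, hx, rfl⟩
    have hx1 : ‖(x, (1 : ℝ))‖ ≤ max R 1 := by
      rw [Prod.norm_mk]
      exact max_le_max (hR x hx) (by simp)
    have hm : 0 < max R 1 := by positivity
    rw [norm_smul, Real.norm_of_nonneg ht.le]
    simp only [ContinuousLinearMap.coe_snd', Prod.smul_snd, smul_eq_mul, mul_one]
    rw [inv_mul_le_iff₀ hm, mul_comm]
    gcongr

lemma IsIrreducibleDomain.exists_smul_notMem (hirr : IsIrreducibleDomain Ω) {φ δ}
    (h : SharpCone (coneOver Ω) φ δ) (P : (Euc d × ℝ) →ₗ[ℝ] (Euc d × ℝ))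
    (hP : IsIdempotentElem P) (hP0 : P ≠ 0) (hP1 : P ≠ 1) :
    ¬ ∀ s : ℝ, 0 < s → ∀ x ∈ coneOver Ω, P x + s • (x - P x) ∈ coneOver Ω := by
  intro hs
  have hPP : ∀ x, P (P x) = P x := fun x => LinearMap.congr_fun hP x
  have hst : ∀ s t : ℝ, 0 < s → 0 < t → ∀ x ∈ coneOver Ω,
      s • P x + t • (x - P x) ∈ coneOver Ω := fun s t hs0 ht0 x hx => by
    have := h.smul_mem hs0 (hs (t / s) (by positivity) x hx)
    rwa [smul_add, smul_smul, mul_div_cancel₀ _ hs0.ne'] at this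
  have hcompl := LinearMap.IsIdempotentElem.isCompl hP
  have hr : LinearMap.range P ≠ ⊥ := fun h0 => hP0 (LinearMap.range_eq_bot.1 h0)
  have hk : LinearMap.ker P ≠ ⊥ := fun h0 => hP1 <| LinearMap.ext fun x => by
    have : x - P x ∈ LinearMap.ker P := by simp [hPP]
    rw [h0, Submodule.mem_bot, sub_eq_zero] at this
    exact this.symm
  refine hirr ⟨LinearMap.range P, LinearMap.ker P, P '' coneOver Ω,
    (LinearMap.id - P : (Euc d × ℝ) →ₗ[ℝ] _) '' coneOver Ω, hr, hk, ?_, ?_, hcompl, ?_, ?_,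
    h.convex.linear_image _, h.convex.linear_image _, ?_, ?_, ?_⟩
  · exact fun h1 => hk (by simpa [h1] using hcompl.inf_eq_bot)
  · exact fun h1 => hr (by simpa [h1] using hcompl.inf_eq_bot)
  · rintro _ ⟨x, -, rfl⟩
    exact ⟨x, rfl⟩
  · rintro _ ⟨x, -, rfl⟩
    simp [hPP]
  · rintro t ht _ ⟨x, hx, rfl⟩
    exact ⟨t • x, h.smul_mem ht hx, map_smul ..⟩
  · rintro t ht _ ⟨x, hx, rfl⟩
    exact ⟨t • x, h.smul_mem ht hx, map_smul ..⟩
  · ext p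
    constructor
    · intro hp
      exact ⟨_, ⟨p, hp, rfl⟩, _, ⟨p, hp, rfl⟩, by simp⟩
    · rintro ⟨_, ⟨x, hx, rfl⟩, _, ⟨y, hy, rfl⟩, rfl⟩
      have hev : ∀ x ∈ coneOver Ω, ∀ y : Euc d × ℝ,
          ∀ᶠ ε in nhdsWithin (0 : ℝ) (Ioi 0), x - ε • y ∈ coneOver Ω := fun x hx y =>
        nhdsWithin_le_nhds ((Continuous.continuousAt (by fun_prop)).preimage_mem_nhds
          (by simpa using h.isOpen.mem_nhds hx))
      obtain ⟨ε, ⟨⟨h1, h2⟩, hε1⟩, hε⟩ := (((hev x hx y).and (hev y hy x)).and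
        (nhdsWithin_le_nhds (Iio_mem_nhds one_pos))).and self_mem_nhdsWithin |>.exists
      have hε0 : (0 : ℝ) < ε := hε
      have hε1' : ε < 1 := hε1
      have hpos : 0 < 1 - ε ^ 2 := by nlinarith
      have := h.smul_mem (inv_pos.2 hpos) (h.add_mem (hst 1 ε one_pos hε0 _ h1)
        (hst ε 1 hε0 one_pos _ h2))
      convert this using 1
      rw [eq_inv_smul_iff₀ hpos.ne']
      simp only [map_sub, map_smul, LinearMap.sub_apply, LinearMap.id_apply]
      module

lemma Divides.exists_dividedCone {Γ : Subgroup ((Euc d × ℝ) ≃ₗ[ℝ] (Euc d × ℝ))}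
    (hdiv : Divides Ω Γ) (hne : Ω.Nonempty) (hbd : Bornology.IsBounded Ω)
    (hop : IsOpen Ω) (hconv : Convex ℝ Ω) (hirr : IsIrreducibleDomain Ω) :
    ∃ δ, DividedCone (coneOver Ω) (ContinuousLinearMap.snd ℝ (Euc d) ℝ) δ Γ := by
  obtain ⟨δ, h⟩ := exists_sharpCone_coneOver hne hbd hop hconv
  obtain ⟨hinv, -, -, K, hKΩ, hK, hcov⟩ := hdiv
  have hinv' : ∀ γ ∈ Γ, ∀ x, γ x ∈ coneOver Ω ↔ x ∈ coneOver Ω := fun γ hγ x => by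
    conv_lhs => rw [← hinv γ hγ]
    exact γ.injective.mem_set_image
  refine ⟨δ, h, hinv', ?_, fun P hP hP0 hP1 => hirr.exists_smul_notMem h P hP hP0 hP1⟩
  refine ⟨(fun x => (x, (1 : ℝ))) '' K, ?_, hK.image (by fun_prop), ?_⟩
  · rintro _ ⟨x, hx, rfl⟩
    exact prod_one_mem_coneOver_iff.2 (hKΩ hx)
  · rintro _ ⟨t, ht, x, hx, rfl⟩
    rw [← hcov] at hx
    simp only [mem_iUnion] at hx
    obtain ⟨γ, hγ, k, hk, rfl⟩ := hx
    have hτ := (mem_coneOver_iff.1 ((hinv' γ hγ _).2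
      (prod_one_mem_coneOver_iff.2 (hKΩ hk)))).1
    refine ⟨γ⁻¹, inv_mem hγ, t⁻¹ * (γ (k, 1)).2, by positivity, k, hk, ?_⟩
    have h1 : γ (k, 1) = (γ (k, 1)).2 • (projAct γ k, (1 : ℝ)) := by
      simp [projAct, smul_smul, hτ.ne']
    have h2 : (k, (1 : ℝ)) = (γ (k, 1)).2 • γ⁻¹ (projAct γ k, (1 : ℝ)) := by
      rw [← map_smul, ← h1]
      exact (γ.symm_apply_apply _).symm
    rw [map_smul, smul_smul, mul_right_comm, inv_mul_cancel₀ ht.ne', one_mul]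
    exact h2

end Domains

section ProjectiveAction

variable {d : ℕ} {Ω : Set (Euc d)}

/-- The points of `Ω` representing the lines of a linear subspace. -/
def coneSlice (Ω : Set (Euc d)) (P : Submodule ℝ (Euc d × ℝ)) : Set (Euc d) :=
  {x ∈ Ω | (x, (1 : ℝ)) ∈ P}

lemma isClosed_prod_one_mem (P : Submodule ℝ (Euc d × ℝ)) :
    IsClosed {x : Euc d | (x, (1 : ℝ)) ∈ P} :=
  P.closed_of_finiteDimensional.preimage (by fun_prop : Continuous fun x : Euc d => (x, (1 : ℝ)))

variable {g h : (Euc d × ℝ) ≃ₗ[ℝ] (Euc d × ℝ)}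

lemma snd_pos_of_mem (hg : ∀ p, g p ∈ coneOver Ω ↔ p ∈ coneOver Ω) {x : Euc d} (hx : x ∈ Ω) :
    0 < (g (x, 1)).2 :=
  (mem_coneOver_iff.1 ((hg _).2 (prod_one_mem_coneOver_iff.2 hx))).1

lemma projAct_mem (hg : ∀ p, g p ∈ coneOver Ω ↔ p ∈ coneOver Ω) {x : Euc d} (hx : x ∈ Ω) :
    projAct g x ∈ Ω :=
  (mem_coneOver_iff.1 ((hg _).2 (prod_one_mem_coneOver_iff.2 hx))).2

lemma apply_prod_one (hg : ∀ p, g p ∈ coneOver Ω ↔ p ∈ coneOver Ω) {x : Euc d} (hx : x ∈ Ω) :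
    g (x, 1) = (g (x, 1)).2 • (projAct g x, (1 : ℝ)) := by
  simp [projAct, smul_smul, (snd_pos_of_mem hg hx).ne']

lemma continuousOn_projAct (hg : ∀ p, g p ∈ coneOver Ω ↔ p ∈ coneOver Ω) :
    ContinuousOn (projAct g) Ω := by
  have hc : Continuous fun x : Euc d => g (x, 1) :=
    (g : (Euc d × ℝ) →ₗ[ℝ] Euc d × ℝ).continuous_of_finiteDimensional.comp
      (by fun_prop : Continuous fun x : Euc d => (x, (1 : ℝ)))
  exact ContinuousOn.smul (f := fun x : Euc d => (g (x, 1)).2⁻¹)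
    (hc.snd.continuousOn.inv₀ fun x hx => (snd_pos_of_mem hg hx).ne') hc.fst.continuousOn

lemma projAct_mul (hh : ∀ p, h p ∈ coneOver Ω ↔ p ∈ coneOver Ω) {x : Euc d} (hx : x ∈ Ω) :
    projAct (g * h) x = projAct g (projAct h x) := by
  have hτ := (snd_pos_of_mem hh hx).ne'
  have hhx := apply_prod_one hh hx
  generalize (h (x, 1)).2 = τ at hτ hhx
  change (g (h (x, 1))).2⁻¹ • (g (h (x, 1))).1 = (g (projAct h x, 1)).2⁻¹ • (g (projAct h x, 1)).1
  rw [hhx, map_smul]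
  simp [smul_smul, hτ]

lemma projAct_inv_projAct (hg : ∀ p, g p ∈ coneOver Ω ↔ p ∈ coneOver Ω) {x : Euc d}
    (hx : x ∈ Ω) : projAct g⁻¹ (projAct g x) = x := by
  rw [← projAct_mul hg hx, inv_mul_cancel]
  simp [projAct]

lemma projAct_mem_coneSlice_map (hg : ∀ p, g p ∈ coneOver Ω ↔ p ∈ coneOver Ω)
    {P : Submodule ℝ (Euc d × ℝ)} {x : Euc d} (hx : x ∈ coneSlice Ω P) :
    projAct g x ∈ coneSlice Ω (P.map (g : (Euc d × ℝ) →ₗ[ℝ] _)) := by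
  refine ⟨projAct_mem hg hx.1, ?_⟩
  have hτ := (snd_pos_of_mem hg hx.1).ne'
  rw [← Submodule.smul_mem_iff _ hτ, ← apply_prod_one hg hx.1]
  exact ⟨_, hx.2, rfl⟩

lemma inv_mem_coneOver_iff (hg : ∀ p, g p ∈ coneOver Ω ↔ p ∈ coneOver Ω) (p : Euc d × ℝ) :
    g⁻¹ p ∈ coneOver Ω ↔ p ∈ coneOver Ω := by
  rw [← hg]
  exact iff_of_eq (congrArg (· ∈ coneOver Ω) (g.apply_symm_apply p))

lemma image_coneSlice (hg : ∀ p, g p ∈ coneOver Ω ↔ p ∈ coneOver Ω)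
    (P : Submodule ℝ (Euc d × ℝ)) :
    projAct g '' coneSlice Ω P = coneSlice Ω (P.map (g : (Euc d × ℝ) →ₗ[ℝ] _)) := by
  refine subset_antisymm (image_subset_iff.2 fun x hx => projAct_mem_coneSlice_map hg hx)
    fun x hx => ⟨projAct g⁻¹ x, ?_, ?_⟩
  · convert projAct_mem_coneSlice_map (inv_mem_coneOver_iff hg) hx
    rw [← Submodule.map_comp]
    exact (Submodule.map_id P).symm.trans (congrArg (P.map ·)
      (LinearMap.ext fun p => (g.symm_apply_apply p).symm))
  · simpa using projAct_inv_projAct (inv_mem_coneOver_iff hg) hx.1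

lemma IsFlatWith.isFrame [NeZero d] {φ δ} (hC : SharpCone (coneOver Ω) φ δ)
    {v : Fin d → Euc d} (hv : IsFlatWith Ω v) :
    IsFrame (coneOver Ω) fun i => (v i, (1 : ℝ)) := by
  obtain ⟨hind, -, hinter, hbdry⟩ := hv
  have hnorm : ∀ a : Fin d → ℝ, 0 < ∑ i, a i → ∑ i, ((∑ i, a i)⁻¹ * a i) • (v i, (1 : ℝ)) =
      ((∑ i, a i)⁻¹ • ∑ i, a i • v i, 1) := fun a hs => by
    simp only [mul_smul, ← Finset.smul_sum]
    rw [sum_smul_prod_one]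
    simp [hs.ne']
  have hpos : ∀ a : Fin d → ℝ, (∀ i, 0 < a i) → ∑ i, a i • (v i, (1 : ℝ)) ∈ coneOver Ω := by
    intro a ha
    have hs : 0 < ∑ i, a i := Finset.sum_pos (fun i _ => ha i) Finset.univ_nonempty
    rw [sum_smul_prod_one, mem_coneOver_iff]
    exact ⟨hs, hinter (hind.mem_intrinsicInterior_iff.2 ⟨fun i => (∑ i, a i)⁻¹ * a i,
      fun i => mul_pos (inv_pos.2 hs) (ha i), hnorm a hs⟩)⟩
  refine fun a => ⟨fun ha => ?_, hpos a⟩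
  by_contra! hneg
  obtain ⟨j, hj⟩ := hneg
  obtain ⟨i₀, -, hi₀⟩ := Finset.exists_min_image Finset.univ a Finset.univ_nonempty
  have hb : ∑ i, (a i - a i₀) • (v i, (1 : ℝ)) ∈ coneOver Ω := by
    have h1 := hC.closure_smul_mem (neg_nonneg.2 ((hi₀ j (Finset.mem_univ j)).trans hj))
      (subset_closure (hpos (fun _ => 1) fun _ => one_pos))
    have h2 := hC.add_closure_mem ha h1
    rw [Finset.smul_sum, ← Finset.sum_add_distrib] at h2
    convert h2 using 3
    module
  rw [sum_smul_prod_one, mem_coneOver_iff] at hb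
  obtain ⟨hs, hx⟩ := hb
  have hw := hnorm (fun i => a i - a i₀) hs
  refine (hbdry ⟨mem_convexHull_range_iff.2 ⟨_, fun i => mul_nonneg (inv_nonneg.2 hs.le)
    (sub_nonneg.2 (hi₀ i (Finset.mem_univ i))), hw⟩, fun hmem => ?_⟩).2 hx
  obtain ⟨w, hw0, hw'⟩ := hind.mem_intrinsicInterior_iff.1 hmem
  have := hind.linearIndependent_prod_one.fintypeLinearCombination_injective
    (a₁ := w) (a₂ := fun i => (∑ i, (a i - a i₀))⁻¹ * (a i - a i₀)) (hw'.trans hw.symm)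
  have hi := congrFun this i₀
  simp only [sub_self, mul_zero] at hi
  exact (hw0 i₀).ne' hi

lemma IsFlatWith.intrinsicInterior_eq [NeZero d] {φ δ} (hC : SharpCone (coneOver Ω) φ δ)
    {v : Fin d → Euc d} (hv : IsFlatWith Ω v) :
    intrinsicInterior ℝ (convexHull ℝ (range v)) =
      coneSlice Ω (Submodule.span ℝ (range fun i => (v i, (1 : ℝ)))) := by
  ext x
  rw [hv.1.mem_intrinsicInterior_iff]
  constructor
  · rintro ⟨w, hw, hwx⟩
    refine ⟨prod_one_mem_coneOver_iff.1 (hwx ▸ (hv.isFrame hC w).2 hw), ?_⟩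
    rw [← hwx]
    exact Submodule.sum_mem _ fun i _ => Submodule.smul_mem _ _ (Submodule.subset_span ⟨i, rfl⟩)
  · rintro ⟨hx, hxs⟩
    obtain ⟨w, hw⟩ := (Submodule.mem_span_range_iff_exists_fun ℝ).1 hxs
    exact ⟨w, (hv.isFrame hC w).1 (hw ▸ prod_one_mem_coneOver_iff.2 hx), hw⟩

/-- The slices of a sequence of subspaces come close to every point of a limit flat. -/
lemma FlatsConverge.exists_tendsto {Ps : ℕ → Submodule ℝ (Euc d × ℝ)}
    {P : Submodule ℝ (Euc d × ℝ)} (hbd : Bornology.IsBounded Ω)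
    (hne : ∀ n, (coneSlice Ω (Ps n)).Nonempty)
    (hconv : FlatsConverge (fun n => coneSlice Ω (Ps n)) (coneSlice Ω P))
    {y : Euc d × ℝ} (hy : y ∈ coneOver Ω) (hyP : y ∈ P) :
    ∃ zs : ℕ → Euc d × ℝ, (∀ n, zs n ∈ Ps n) ∧ Tendsto zs atTop (nhds y) := by
  obtain ⟨t, ht, x, hx, rfl⟩ := hy
  have hxP : x ∈ coneSlice Ω P := ⟨hx, (Submodule.smul_mem_iff _ ht.ne').1 hyP⟩
  have hfin : ∀ n, hausdorffEDist (closure (coneSlice Ω P)) (closure (coneSlice Ω (Ps n))) ≠ ⊤ :=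
    fun n => hausdorffEDist_ne_top_of_nonempty_of_bounded (closure_nonempty_iff.2 ⟨x, hxP⟩)
      (hne n).closure (hbd.subset fun _ h => h.1).closure (hbd.subset fun _ h => h.1).closure
  have hex : ∀ n : ℕ, ∃ z ∈ closure (coneSlice Ω (Ps n)), dist x z <
      hausdorffDist (closure (coneSlice Ω (Ps n))) (closure (coneSlice Ω P)) + 1 / ((n : ℝ) + 1) :=
    fun n => exists_dist_lt_of_hausdorffDist_lt (subset_closure hxP)
      (by rw [hausdorffDist_comm]; exact lt_add_of_pos_right _ (by positivity)) (hfin n)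
  choose z hz hzd using hex
  refine ⟨fun n => t • (z n, (1 : ℝ)), fun n => Submodule.smul_mem _ _
    (closure_minimal (fun _ h => h.2) (isClosed_prod_one_mem (Ps n)) (hz n)), ?_⟩
  have hzx : Tendsto z atTop (nhds x) := by
    rw [tendsto_iff_dist_tendsto_zero]
    refine squeeze_zero (fun _ => dist_nonneg) (fun n => ?_)
      (add_zero (0 : ℝ) ▸ Tendsto.add hconv tendsto_one_div_add_atTop_nhds_zero_nat)
    rw [dist_comm]
    exact (hzd n).le
  exact (hzx.prodMk_nhds tendsto_const_nhds).const_smul t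

end ProjectiveAction

section Flats

variable {d : ℕ} {Ω : Set (Euc d)} {Γ : Subgroup ((Euc d × ℝ) ≃ₗ[ℝ] (Euc d × ℝ))}
  {φ : Euc d × ℝ →L[ℝ] ℝ} {δ : ℝ} {e : Fin d → Euc d × ℝ}

lemma DividedCone.exists_compact_cover_coneSlice (h : DividedCone (coneOver Ω) φ δ Γ)
    (hd : 3 ≤ d) (he : IsFrame (coneOver Ω) e) {K : Set (Euc d)} (hKΩ : K ⊆ Ω)
    (hK : IsCompact K) (hcov : ⋃ γ ∈ Γ, projAct γ '' K = Ω) {F : Set (Euc d)}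
    (hF : F = coneSlice Ω (Submodule.span ℝ (range e))) :
    ∃ K₀ : Set (Euc d), K₀ ⊆ F ∧ IsCompact K₀ ∧
      (⋃ γ ∈ {γ : (Euc d × ℝ) ≃ₗ[ℝ] (Euc d × ℝ) | γ ∈ Γ ∧ projAct γ '' F = F},
        projAct γ '' K₀) = F := by
  set S : Submodule ℝ (Euc d × ℝ) := Submodule.span ℝ (range e) with hS
  have hfr : Module.finrank ℝ (Euc d × ℝ) = Fintype.card (Fin d) + 1 := by simp
  have hinv : ∀ γ ∈ Γ, ∀ p, γ p ∈ coneOver Ω ↔ p ∈ coneOver Ω := h.invariant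
  set A : Set (Submodule ℝ (Euc d × ℝ)) := {P | (∃ γ ∈ Γ,
    P = S.map (γ : (Euc d × ℝ) →ₗ[ℝ] Euc d × ℝ)) ∧ ∃ k ∈ K, (k, (1 : ℝ)) ∈ P} with hA
  have hfin : A.Finite := by
    refine (h.finite_spans_meeting_compact hfr (by simpa using hd)
      (K := (fun x => (x, (1 : ℝ))) '' K) ?_ (hK.image (by fun_prop))).subset ?_
    · rintro _ ⟨x, hx, rfl⟩
      exact prod_one_mem_coneOver_iff.2 (hKΩ hx)
    · rintro _ ⟨⟨γ, hγ, rfl⟩, k, hk, hkP⟩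
      exact ⟨⟨_, h.isFrame_comp hγ he, span_range_comp γ e⟩, _, ⟨k, hk, rfl⟩, hkP⟩
  have hch : ∀ P : A, ∃ γ ∈ Γ, P.1 = S.map (γ : (Euc d × ℝ) →ₗ[ℝ] Euc d × ℝ) := fun P => P.2.1
  choose g hgΓ hg using hch
  have hgF : ∀ P : A, projAct (g P) '' F = coneSlice Ω P.1 := fun P => by
    rw [hF, image_coneSlice (hinv _ (hgΓ P)), ← hg]
  have hback : ∀ P : A, ∀ x ∈ coneSlice Ω P.1, projAct (g P)⁻¹ x ∈ F := by
    intro P x hx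
    rw [← hgF P] at hx
    obtain ⟨y, hy, rfl⟩ := hx
    rwa [projAct_inv_projAct (hinv _ (hgΓ P)) (hF ▸ hy : y ∈ coneSlice Ω S).1]
  have := hfin.to_subtype
  have hsub : ⋃ P : A, projAct (g P)⁻¹ '' (K ∩ {x | (x, (1 : ℝ)) ∈ P.1}) ⊆ F :=
    iUnion_subset fun P => image_subset_iff.2 fun x hx => hback P x ⟨hKΩ hx.1, hx.2⟩
  refine ⟨_, hsub, ?_, ?_⟩
  · exact isCompact_iUnion fun P => (hK.inter_right (isClosed_prod_one_mem _)).image_of_continuousOn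
      ((continuousOn_projAct (inv_mem_coneOver_iff (hinv _ (hgΓ P)))).mono
        (inter_subset_left.trans hKΩ))
  · refine subset_antisymm ?_ fun x hx => ?_
    · exact iUnion₂_subset fun γ hγ => (image_mono hsub).trans hγ.2.subset
    · have hxS : x ∈ coneSlice Ω S := hF ▸ hx
      have hxΩ := hxS.1
      rw [← hcov] at hxΩ
      simp only [mem_iUnion] at hxΩ
      obtain ⟨γ, hγ, k, hk, rfl⟩ := hxΩ
      have hkΩ := hKΩ hk
      have hkP := projAct_mem_coneSlice_map (hinv _ (inv_mem hγ)) hxS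
      rw [projAct_inv_projAct (hinv γ hγ) hkΩ] at hkP
      set P : A := ⟨_, ⟨γ⁻¹, inv_mem hγ, rfl⟩, k, hk, hkP.2⟩ with hP
      have hkF := hback P k hkP
      refine mem_iUnion₂.2 ⟨γ * g P, ⟨mul_mem hγ (hgΓ P), ?_⟩, projAct (g P)⁻¹ k,
        mem_iUnion.2 ⟨P, k, ⟨hk, hkP.2⟩, rfl⟩, ?_⟩
      · have h1 : projAct (γ * g P) '' F = projAct γ '' (projAct (g P) '' F) := by
          rw [image_image]
          exact image_congr fun y hy =>
            projAct_mul (hinv _ (hgΓ P)) (hF ▸ hy : y ∈ coneSlice Ω S).1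
        rw [h1, hgF, hP, ← image_coneSlice (hinv _ (inv_mem hγ)), image_image, ← hF]
        have h2 : ∀ y ∈ F, projAct γ (projAct γ⁻¹ y) = y := fun y hy => by
          simpa using projAct_inv_projAct (hinv _ (inv_mem hγ))
            (hF ▸ hy : y ∈ coneSlice Ω S).1
        rw [image_congr h2, image_id']
      · rw [projAct_mul (hinv _ (hgΓ P)) (hF ▸ hkF : _ ∈ coneSlice Ω S).1]
        congr 1
        simpa using projAct_inv_projAct (hinv _ (inv_mem (hgΓ P))) hkΩ

lemma DividedCone.not_flatsConverge (h : DividedCone (coneOver Ω) φ δ Γ)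
    (hbd : Bornology.IsBounded Ω) (hd : 3 ≤ d) (he : IsFrame (coneOver Ω) e)
    {F : Set (Euc d)} (hF : F = coneSlice Ω (Submodule.span ℝ (range e))) (hne : F.Nonempty)
    {e' : Fin d → Euc d × ℝ} (he' : IsFrame (coneOver Ω) e')
    {γs : ℕ → (Euc d × ℝ) ≃ₗ[ℝ] (Euc d × ℝ)} (hγ : ∀ i, γs i ∈ Γ)
    (hpair : ∀ i j, i ≠ j → projAct (γs i) '' F ≠ projAct (γs j) '' F) :
    ¬ FlatsConverge (fun i => projAct (γs i) '' F)
      (coneSlice Ω (Submodule.span ℝ (range e'))) := by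
  intro hconv
  have him : ∀ i, projAct (γs i) '' F =
      coneSlice Ω (Submodule.span ℝ (range fun j => γs i (e j))) := fun i => by
    rw [hF, image_coneSlice (h.invariant _ (hγ i)), span_range_comp]
  refine h.false_of_injective_frames (by simp) (by simpa using hd) he'
    (E := fun n j => γs n (e j)) (fun n => h.isFrame_comp (hγ n) he) (fun i j hij => ?_)
    fun y hy hyP => FlatsConverge.exists_tendsto hbd (fun n => him n ▸ hne.image _) ?_ hy hyP
  · by_contra hne
    refine hpair i j hne ?_
    rw [him, him]
    exact congrArg _ hij
  · simpa only [him] using hconv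

end Flats

theorem boundary_flat_cocompact_and_discrete_orbit {d : ℕ} (Ω : Set (Euc d)) (hne : Ω.Nonempty)
    (hbd : Bornology.IsBounded Ω) (hop : IsOpen Ω) (hconv : Convex ℝ Ω)
    (hd : 3 ≤ d) (hirr : IsIrreducibleDomain Ω)
    (Γ : Subgroup ((Euc d × ℝ) ≃ₗ[ℝ] (Euc d × ℝ)))
    (htf : TorsionFreeSub Γ) (hdiv : Divides Ω Γ)
    (F : Set (Euc d)) (hF : IsBoundaryFlat Ω F) :
    (∃ K₀ : Set (Euc d), K₀ ⊆ F ∧ IsCompact K₀ ∧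
      (⋃ γ ∈ {γ : (Euc d × ℝ) ≃ₗ[ℝ] (Euc d × ℝ) | γ ∈ Γ ∧ projAct γ '' F = F},
        projAct γ '' K₀) = F) ∧
    ¬ ∃ (γs : ℕ → (Euc d × ℝ) ≃ₗ[ℝ] (Euc d × ℝ)) (F' : Set (Euc d)),
        (∀ i, γs i ∈ Γ) ∧ IsFlat Ω F' ∧
        (∀ i j, i ≠ j → projAct (γs i) '' F ≠ projAct (γs j) '' F) ∧
        FlatsConverge (fun i => projAct (γs i) '' F) F' := by
  have : NeZero d := ⟨by omega⟩
  obtain ⟨δ, h⟩ := hdiv.exists_dividedCone hne hbd hop hconv hirr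
  obtain ⟨⟨v, hv, hFv⟩, -⟩ := hF
  rw [hv.intrinsicInterior_eq h.toSharpCone] at hFv
  have he := hv.isFrame h.toSharpCone
  obtain ⟨-, -, -, K, hKΩ, hK, hcov⟩ := hdiv
  obtain ⟨K₀, hK₀F, hK₀, hcov₀⟩ := h.exists_compact_cover_coneSlice hd he hKΩ hK hcov hFv
  refine ⟨⟨K₀, hK₀F, hK₀, hcov₀⟩, ?_⟩
  rintro ⟨γs, F', hγ, ⟨v', hv', rfl⟩, hpair, hlim⟩
  have hne' : F.Nonempty := by
    rw [hFv, ← hv.intrinsicInterior_eq h.toSharpCone]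
    exact (convexHull_nonempty_iff.2 (range_nonempty v)).intrinsicInterior (convex_convexHull ℝ _)
  rw [hv'.intrinsicInterior_eq h.toSharpCone] at hlim
  exact h.not_flatsConverge hbd hd he hFv hne' (hv'.isFrame h.toSharpCone) hγ hpair hlim
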